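/- arXiv:1807.11194 — 3 statements merged into one kernel-verified Lean document; each statement's English description precedes it below -/
import Mathlib

section
/- Let J ⊆ I, let W_J be the parabolic subgroup of the Weyl group W generated by {s_b : b ∈ J}, and let Φ⁺(J) = {α ∈ Φ⁺ : [α]_b = 0 for all b ∈ I∖J}. Then in the group algebra ℤ[Q] one has ∑_{w∈W_J} det(w) · e^{w(ρ) − ρ} = ∏_{α ∈ Φ⁺(J)} (1 − e^{−α}), where det(w) = (−1)^{ℓ(w)} is the sign of w. -/
open scoped Classical

/-- The exponential `e^v` in the group algebra `ℤ[V]` (containing `ℤ[Q]`). -/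
noncomputable def expZ {V : Type*} [AddCommGroup V] (v : V) : AddMonoidAlgebra ℤ V :=
  AddMonoidAlgebra.single v 1

/-- The sign `det w = (-1)^{ℓ(w)}` of an element of the Weyl group, computed via the
determinant of `w` as a linear automorphism. -/
noncomputable def sgn {V : Type*} [AddCommGroup V] [Module ℚ V] (w : V ≃ₗ[ℚ] V) : ℤ :=
  if LinearMap.det (w : V →ₗ[ℚ] V) = 1 then 1 else -1

/-!
STATEMENT 3.  Let `J ⊆ I`, let `W_J` be the parabolic subgroup of the Weyl group generated
by the simple reflections `s b` for `b ∈ J`, and let `Φ⁺(J)` be the set of positive roots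
supported on `J`.  Then, in `ℤ[Q]`:
`∑_{w ∈ W_J} det(w) e^{w(ρ) - ρ} = ∏_{α ∈ Φ⁺(J)} (1 - e^{-α})`,
where `ρ` is the half-sum of the positive roots.
-/
/-- Abstract data for the (parabolic) denominator formula. -/
structure PS {K V : Type*} [AddCommGroup V] [Module ℚ V]
    (B : V →ₗ[ℚ] V →ₗ[ℚ] ℚ) (a : K → V) (c : K → V →ₗ[ℚ] ℚ) (s : K → V ≃ₗ[ℚ] V)
    (Ψ : Finset V) : Prop where
  symm : ∀ x y, B x y = B y x
  pos : ∀ x, x ≠ 0 → 0 < B x x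
  hs : ∀ k v, s k v = v - c k v • a k
  two : ∀ k, c k (a k) = 2
  hBc : ∀ k v, 2 * B v (a k) = c k v * B (a k) (a k)
  int : ∀ k j, ∃ n : ℤ, c k (a j) = n
  mem : ∀ k, a k ∈ Ψ
  ne : ∀ α ∈ Ψ, α ≠ 0
  cone : ∀ α ∈ Ψ, α ∈ AddSubmonoid.closure (Set.range a)
  neg : ∀ α ∈ Ψ, -α ∉ Ψ
  perm : ∀ k, ∀ α ∈ Ψ, α ≠ a k → s k α ∈ Ψ

namespace PS

variable {K V : Type*} [AddCommGroup V] [Module ℚ V]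
    {B : V →ₗ[ℚ] V →ₗ[ℚ] ℚ} {a : K → V} {c : K → V →ₗ[ℚ] ℚ} {s : K → V ≃ₗ[ℚ] V}
    {Ψ : Finset V}

/-- Half-sum. -/
noncomputable def hsum (Ψ : Finset V) : V := (2 : ℚ)⁻¹ • ∑ α ∈ Ψ, α

theorem pos' (h : PS B a c s Ψ) (k : K) : 0 < B (a k) (a k) :=
  h.pos _ (h.ne _ (h.mem k))

theorem s_a (h : PS B a c s Ψ) (k : K) : s k (a k) = - a k := by
  rw [h.hs, h.two, two_smul]; abel

theorem s_s (h : PS B a c s Ψ) (k : K) (v : V) : s k (s k v) = v := by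
  rw [h.hs k v, map_sub, map_smul, h.s_a, h.hs]
  module

theorem s_mul (h : PS B a c s Ψ) (k : K) : s k * s k = 1 := by
  ext v; exact h.s_s k v

theorem s_inv (h : PS B a c s Ψ) (k : K) : (s k)⁻¹ = s k :=
  inv_eq_of_mul_eq_one_left (h.s_mul k)

theorem iso (h : PS B a c s Ψ) (k : K) (x y : V) : B (s k x) (s k y) = B x y := by
  have h1 := h.hBc k x
  have h2 := h.hBc k y
  rw [h.symm y] at h2
  simp only [h.hs, map_sub, map_smul, LinearMap.sub_apply, LinearMap.smul_apply, smul_eq_mul]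
  linear_combination (-c k y / 2) * h1 - (c k x / 2) * h2

/-- word product -/
def wd (s : K → V ≃ₗ[ℚ] V) (l : List K) : V ≃ₗ[ℚ] V := (l.map s).prod

theorem wd_nil : wd s [] = 1 := rfl

theorem wd_cons (k : K) (l : List K) : wd s (k :: l) = s k * wd s l := by simp [wd]

theorem wd_append (l m : List K) : wd s (l ++ m) = wd s l * wd s m := by simp [wd]

theorem wd_iso (h : PS B a c s Ψ) (l : List K) (x y : V) :
    B (wd s l x) (wd s l y) = B x y := by
  induction l with
  | nil => rfl
  | cons k l ih => rw [wd_cons]; exact (h.iso k _ _).trans ih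

theorem exists_wd (h : PS B a c s Ψ) {w : V ≃ₗ[ℚ] V}
    (hw : w ∈ Subgroup.closure (Set.range s)) : ∃ l, w = wd s l := by
  induction hw using Subgroup.closure_induction with
  | mem x hx => obtain ⟨k, rfl⟩ := hx; exact ⟨[k], by simp [wd]⟩
  | one => exact ⟨[], rfl⟩
  | mul x y _ _ hx hy =>
    obtain ⟨l, rfl⟩ := hx
    obtain ⟨m, rfl⟩ := hy
    exact ⟨l ++ m, (wd_append l m).symm⟩
  | inv x _ hx =>
    obtain ⟨l, rfl⟩ := hx
    refine ⟨l.reverse, ?_⟩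
    clear * - h
    induction l with
    | nil => simp [wd]
    | cons k l ih =>
      rw [wd_cons, mul_inv_rev, ih, List.reverse_cons, wd_append, h.s_inv]
      simp [wd]

theorem hsum_refl (Ψ : Finset V) (g : V ≃ₗ[ℚ] V) (x : V) (hx : x ∈ Ψ) (hgx : g x = -x)
    (hgg : ∀ v, g (g v) = v) (key : ∀ α ∈ Ψ.erase x, g α ∈ Ψ.erase x) :
    g (hsum Ψ) = hsum Ψ - x := by
  have e : ∑ α ∈ Ψ.erase x, g α = ∑ α ∈ Ψ.erase x, α :=
    Finset.sum_nbij' g g key key (fun x _ => hgg x) (fun x _ => hgg x) (fun _ _ => rfl)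
  unfold hsum
  rw [map_smul, map_sum, ← Finset.add_sum_erase _ _ hx, e,
    ← Finset.add_sum_erase _ _ hx, hgx]
  module

theorem perm_erase (h : PS B a c s Ψ) (k : K) : ∀ α ∈ Ψ.erase (a k), s k α ∈ Ψ.erase (a k) := by
  intro α hα
  rw [Finset.mem_erase] at hα ⊢
  refine ⟨?_, h.perm k α hα.2 hα.1⟩
  intro e
  have e2 := h.s_s k α
  rw [e, h.s_a] at e2
  exact h.neg _ (h.mem k) (e2 ▸ hα.2)

theorem s_hsum (h : PS B a c s Ψ) (k : K) : s k (hsum Ψ) = hsum Ψ - a k :=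
  hsum_refl Ψ (s k) (a k) (h.mem k) (h.s_a k) (h.s_s k) (h.perm_erase k)

theorem c_hsum (h : PS B a c s Ψ) (k : K) : c k (hsum Ψ) = 1 := by
  have e := congrArg (c k) (h.s_hsum k)
  rw [h.hs, map_sub, map_sub, map_smul, h.two, smul_eq_mul] at e
  linarith

theorem hsum_pos_simple (h : PS B a c s Ψ) (k : K) : 0 < B (hsum Ψ) (a k) := by
  have := h.hBc k (hsum Ψ)
  rw [h.c_hsum] at this
  have := h.pos' k
  linarith

theorem cone_nonneg {ν x : V} (hν : ∀ k, 0 ≤ B ν (a k))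
    (hx : x ∈ AddSubmonoid.closure (Set.range a)) : 0 ≤ B ν x := by
  induction hx using AddSubmonoid.closure_induction with
  | mem x hx => obtain ⟨k, rfl⟩ := hx; exact hν k
  | zero => simp
  | add x y _ _ hx hy => rw [map_add]; exact add_nonneg hx hy

theorem cone_pos (h : PS B a c s Ψ) {x : V}
    (hx : x ∈ AddSubmonoid.closure (Set.range a)) : x = 0 ∨ 0 < B (hsum Ψ) x := by
  induction hx using AddSubmonoid.closure_induction with
  | mem x hx => obtain ⟨k, rfl⟩ := hx; exact Or.inr (h.hsum_pos_simple k)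
  | zero => simp
  | add x y _ _ hx hy =>
    rcases hx with rfl | hx
    · simpa using hy
    · rcases hy with rfl | hy
      · simpa using Or.inr hx
      · right; rw [map_add]; exact add_pos hx hy

theorem hsum_pos (h : PS B a c s Ψ) {α : V} (hα : α ∈ Ψ) : 0 < B (hsum Ψ) α :=
  (h.cone_pos (h.cone α hα)).resolve_left (h.ne α hα)

theorem s_root (h : PS B a c s Ψ) (k : K) {α : V} (hα : α ∈ Ψ ∨ -α ∈ Ψ) :
    s k α ∈ Ψ ∨ -s k α ∈ Ψ := by
  rcases hα with hα | hα
  · by_cases e : α = a k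
    · right; rw [e, h.s_a, neg_neg]; exact h.mem k
    · exact Or.inl (h.perm k α hα e)
  · by_cases e : -α = a k
    · left
      have : α = - a k := by rw [← e, neg_neg]
      rw [this, map_neg, h.s_a, neg_neg]; exact h.mem k
    · right; rw [← map_neg]; exact h.perm k _ hα e

theorem wd_root (h : PS B a c s Ψ) (l : List K) {α : V} (hα : α ∈ Ψ) :
    wd s l α ∈ Ψ ∨ -wd s l α ∈ Ψ := by
  induction l with
  | nil => exact Or.inl hα
  | cons k l ih => rw [wd_cons]; exact h.s_root k ih

theorem conj (h : PS B a c s Ψ) (l : List K) {j k : K} (e : wd s l (a k) = a j) :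
    wd s l * s k = s j * wd s l := by
  ext v
  change wd s l (s k v) = s j (wd s l v)
  rw [h.hs, h.hs, map_sub, map_smul, e]
  congr 2
  have h1 := h.hBc j (wd s l v)
  rw [← e, h.wd_iso, h.wd_iso, h.hBc] at h1
  exact mul_right_cancel₀ (h.pos' k).ne' h1

theorem exchange (h : PS B a c s Ψ) (l : List K) (k : K) (hl : -(wd s l (a k)) ∈ Ψ) :
    ∃ l' : List K, l'.length + 1 = l.length ∧ wd s l' = wd s l * s k := by
  induction l with
  | nil => exact absurd hl (h.neg _ (h.mem k))
  | cons j t ih =>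
    rcases h.wd_root t (h.mem k) with hp | hn
    · have e : wd s t (a k) = a j := by
        by_contra hne
        have h1 := h.perm j _ hp hne
        exact h.neg _ h1 hl
      refine ⟨t, rfl, ?_⟩
      rw [wd_cons, mul_assoc, h.conj t e, ← mul_assoc, h.s_mul, one_mul]
    · obtain ⟨t', h1, h2⟩ := ih hn
      refine ⟨j :: t', by simp [h1], ?_⟩
      rw [wd_cons, wd_cons, h2, mul_assoc]

theorem stab_aux (h : PS B a c s Ψ) (n : ℕ) : ∀ l : List K, l.length ≤ n →
    (∀ k, wd s l (a k) ∈ Ψ) → wd s l = 1 := by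
  induction n with
  | zero =>
    intro l hl _
    have : l = [] := List.length_eq_zero_iff.1 (Nat.le_zero.1 hl)
    rw [this, wd_nil]
  | succ n ih =>
    intro l hl hp
    rcases List.eq_nil_or_concat' l with rfl | ⟨t, k, rfl⟩
    · rfl
    · have e : wd s (t ++ [k]) = wd s t * s k := by rw [wd_append]; simp [wd]
      have h1 := hp k
      rw [e] at h1
      change wd s t (s k (a k)) ∈ Ψ at h1
      rw [h.s_a, map_neg] at h1
      obtain ⟨t', h2, h3⟩ := h.exchange t k h1
      rw [e, ← h3]
      rw [List.length_append] at hl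
      simp only [List.length_singleton] at hl
      exact ih t' (by omega) (fun j => by rw [h3, ← e]; exact hp j)

theorem stab (h : PS B a c s Ψ) (l : List K) (hl : wd s l (hsum Ψ) = hsum Ψ) :
    wd s l = 1 := by
  refine h.stab_aux _ l le_rfl (fun k => ?_)
  rcases h.wd_root l (h.mem k) with hp | hn
  · exact hp
  · have h1 := h.hsum_pos hn
    have h2 := h.wd_iso l (hsum Ψ) (a k)
    rw [hl] at h2
    rw [map_neg, h2] at h1
    have := h.hsum_pos_simple k
    linarith

theorem det_s [FiniteDimensional ℚ V] (h : PS B a c s Ψ) (k : K) :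
    LinearMap.det (s k : V →ₗ[ℚ] V) = -1 := by
  have : (s k : V →ₗ[ℚ] V) = LinearMap.transvection (-c k) (a k) := by
    ext v
    simp [LinearMap.transvection, h.hs, sub_eq_add_neg]
  rw [this, LinearMap.transvection.det]
  simp [h.two]; norm_num

theorem det_s_mul [FiniteDimensional ℚ V] (h : PS B a c s Ψ) (k : K) (w : V ≃ₗ[ℚ] V) :
    LinearMap.det ((s k * w : V ≃ₗ[ℚ] V) : V →ₗ[ℚ] V) = - LinearMap.det (w : V →ₗ[ℚ] V) := by
  have : ((s k * w : V ≃ₗ[ℚ] V) : V →ₗ[ℚ] V) = (s k : V →ₗ[ℚ] V) * (w : V →ₗ[ℚ] V) := rfl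
  rw [this, map_mul, h.det_s]; ring

theorem det_wd [FiniteDimensional ℚ V] (h : PS B a c s Ψ) (l : List K) :
    LinearMap.det (wd s l : V →ₗ[ℚ] V) = 1 ∨ LinearMap.det (wd s l : V →ₗ[ℚ] V) = -1 := by
  induction l with
  | nil =>
    left
    have : ((wd s [] : V ≃ₗ[ℚ] V) : V →ₗ[ℚ] V) = 1 := rfl
    rw [this, map_one]
  | cons k l ih =>
    rw [wd_cons, h.det_s_mul]
    rcases ih with e | e <;> rw [e] <;> simp

theorem sgn_s_mul [FiniteDimensional ℚ V] (h : PS B a c s Ψ) (k : K) (l : List K) :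
    sgn (s k * wd s l) = - sgn (wd s l) := by
  unfold sgn
  rw [h.det_s_mul]
  rcases h.det_wd l with e | e <;> rw [e] <;> norm_num

/-- The action of a simple reflection on the group algebra. -/
noncomputable def act (g : V ≃ₗ[ℚ] V) : AddMonoidAlgebra ℤ V →+* AddMonoidAlgebra ℤ V :=
  AddMonoidAlgebra.mapDomainRingHom ℤ (g.toLinearMap.toAddMonoidHom)

theorem act_single (g : V ≃ₗ[ℚ] V) (v : V) (z : ℤ) :
    act g (AddMonoidAlgebra.single v z) = AddMonoidAlgebra.single (g v) z := by
  simp [act]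

theorem act_expZ (g : V ≃ₗ[ℚ] V) (v : V) : act g (expZ v) = expZ (g v) := act_single g v 1

theorem coeff_act (g : V ≃ₗ[ℚ] V) (x : AddMonoidAlgebra ℤ V) (v : V) :
    (act g x).coeff (g v) = x.coeff v := by
  change (Finsupp.mapDomain g x.coeff) (g v) = x.coeff v
  exact Finsupp.mapDomain_apply g.injective _ _

theorem expZ_add (v w : V) : expZ (v + w) = expZ v * expZ w := by
  simp [expZ, AddMonoidAlgebra.single_mul_single]

theorem prod_anti (h : PS B a c s Ψ) (k : K) :
    expZ (-a k) * act (s k) (∏ α ∈ Ψ, (1 - expZ (-α))) = - ∏ α ∈ Ψ, (1 - expZ (-α)) := by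
  have e : ∏ α ∈ Ψ.erase (a k), (1 - expZ (-s k α)) = ∏ α ∈ Ψ.erase (a k), (1 - expZ (-α)) :=
    Finset.prod_nbij' (s k) (s k) (h.perm_erase k) (h.perm_erase k)
      (fun x _ => h.s_s k x) (fun x _ => h.s_s k x) (fun _ _ => rfl)
  rw [map_prod]
  simp only [map_sub, map_one, act_expZ, map_neg]
  rw [← Finset.mul_prod_erase _ _ (h.mem k), e, ← Finset.mul_prod_erase _ _ (h.mem k), h.s_a,
    neg_neg]
  have e1 : expZ (-a k) * expZ (a k) = 1 := by
    rw [← expZ_add, neg_add_cancel]; rfl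
  linear_combination (-∏ α ∈ Ψ.erase (a k), (1 - expZ (-α))) * e1

theorem sum_anti [FiniteDimensional ℚ V] (h : PS B a c s Ψ) (k : K)
    (hfin : ((Subgroup.closure (Set.range s) : Subgroup (V ≃ₗ[ℚ] V)) :
      Set (V ≃ₗ[ℚ] V)).Finite) :
    expZ (-a k) * act (s k) (∑ w ∈ hfin.toFinset,
      AddMonoidAlgebra.single (w (hsum Ψ) - hsum Ψ) (sgn w)) =
    - ∑ w ∈ hfin.toFinset, AddMonoidAlgebra.single (w (hsum Ψ) - hsum Ψ) (sgn w) := by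
  have hk : s k ∈ Subgroup.closure (Set.range s) := Subgroup.subset_closure ⟨k, rfl⟩
  have key : ∀ w ∈ hfin.toFinset, s k * w ∈ hfin.toFinset := by
    intro w hw
    simp only [Set.Finite.mem_toFinset, SetLike.mem_coe] at hw ⊢
    exact mul_mem hk hw
  have key2 : ∀ w ∈ hfin.toFinset, s k * (s k * w) = w := by
    intro w _
    rw [← mul_assoc, h.s_mul, one_mul]
  rw [map_sum, Finset.mul_sum, ← Finset.sum_neg_distrib]
  refine Finset.sum_nbij' (s k * ·) (s k * ·) key key key2 key2 ?_
  intro w hw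
  simp only [Set.Finite.mem_toFinset, SetLike.mem_coe] at hw
  obtain ⟨l, rfl⟩ := h.exists_wd hw
  rw [act_single, h.sgn_s_mul, AddMonoidAlgebra.single_neg, neg_neg, expZ,
    AddMonoidAlgebra.single_mul_single, one_mul, map_sub, h.s_hsum]
  congr 1
  change _ = s k (wd s l (hsum Ψ)) - _
  abel

theorem coeff_anti (h : PS B a c s Ψ) (k : K) (F : AddMonoidAlgebra ℤ V)
    (hF : expZ (-a k) * act (s k) F = -F) (ν : V) :
    F.coeff (s k (ν + hsum Ψ) - hsum Ψ) = - F.coeff ν := by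
  have e := congrArg (fun x => x.coeff (s k (ν + hsum Ψ) - hsum Ψ)) hF
  simp only [expZ, AddMonoidAlgebra.coeff_single_mul_apply, one_mul,
    AddMonoidAlgebra.coeff_neg, Finsupp.neg_apply] at e
  have e2 : - -a k + (s k (ν + hsum Ψ) - hsum Ψ) = s k ν := by
    rw [map_add, h.s_hsum]; abel
  rw [e2, coeff_act] at e
  linarith

theorem prod_supp (h : PS B a c s Ψ) (S : Finset V) (hS : S ⊆ Ψ) :
    (∀ ν, (∏ α ∈ S, (1 - expZ (-α))).coeff ν ≠ 0 → -ν ∈ AddSubmonoid.closure (Set.range a)) ∧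
    (∏ α ∈ S, (1 - expZ (-α))).coeff 0 = 1 := by
  induction S using Finset.induction_on with
  | empty =>
    simp only [Finset.prod_empty, AddMonoidAlgebra.one_def, AddMonoidAlgebra.coeff_single]
    refine ⟨fun ν hν => ?_, by simp⟩
    have : ν = 0 := by
      by_contra hne
      exact hν (Finsupp.single_eq_of_ne hne)
    rw [this, neg_zero]
    exact zero_mem _
  | insert α S hα ih =>
    obtain ⟨i1, i2⟩ := ih ((Finset.subset_insert _ _).trans hS)
    have hαΨ : α ∈ Ψ := hS (Finset.mem_insert_self _ _)
    have key : ∀ ν, (∏ α ∈ insert α S, (1 - expZ (-α))).coeff ν =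
        (∏ α ∈ S, (1 - expZ (-α))).coeff ν - (∏ α ∈ S, (1 - expZ (-α))).coeff (α + ν) := by
      intro ν
      rw [Finset.prod_insert hα, sub_mul, one_mul, AddMonoidAlgebra.coeff_sub,
        Finsupp.sub_apply, expZ, AddMonoidAlgebra.coeff_single_mul_apply, one_mul, neg_neg]
    constructor
    · intro ν hν
      rw [key] at hν
      by_cases h1 : (∏ α ∈ S, (1 - expZ (-α))).coeff ν = 0
      · have h2 : (∏ α ∈ S, (1 - expZ (-α))).coeff (α + ν) ≠ 0 := by
          intro h2; apply hν; rw [h1, h2, sub_zero]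
        have := add_mem (h.cone α hαΨ) (i1 _ h2)
        have e : α + -(α + ν) = -ν := by abel
        rwa [e] at this
      · exact i1 _ h1
    · rw [key, i2, add_zero]
      have : (∏ α ∈ S, (1 - expZ (-α))).coeff α = 0 := by
        by_contra hne
        have h1 := h.hsum_pos hαΨ
        rcases h.cone_pos (i1 _ hne) with h2 | h2
        · exact h.ne α hαΨ (neg_eq_zero.1 h2)
        · rw [map_neg] at h2; linarith
      rw [this, sub_zero]

theorem lattice_int (h : PS B a c s Ψ) {x : V} (hx : x ∈ AddSubgroup.closure (Set.range a))
    (k : K) : ∃ n : ℤ, c k x = n := by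
  induction hx using AddSubgroup.closure_induction with
  | mem x hx => obtain ⟨j, rfl⟩ := hx; exact h.int k j
  | zero => exact ⟨0, by simp⟩
  | add x y _ _ hx hy =>
    obtain ⟨m, hm⟩ := hx
    obtain ⟨n, hn⟩ := hy
    exact ⟨m + n, by rw [map_add, hm, hn]; push_cast; rfl⟩
  | neg x _ hx =>
    obtain ⟨m, hm⟩ := hx
    exact ⟨-m, by rw [map_neg, hm]; push_cast; rfl⟩

theorem cone_lattice {x : V} (hx : x ∈ AddSubmonoid.closure (Set.range a)) :
    x ∈ AddSubgroup.closure (Set.range a) :=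
  (AddSubmonoid.closure_le (S := (AddSubgroup.closure (Set.range a)).toAddSubmonoid)).2
    AddSubgroup.subset_closure hx

theorem wd_lattice (h : PS B a c s Ψ) (l : List K) :
    wd s l (hsum Ψ) - hsum Ψ ∈ AddSubgroup.closure (Set.range a) := by
  induction l with
  | nil =>
    have : wd s [] (hsum Ψ) - hsum Ψ = 0 := sub_self _
    rw [this]; exact zero_mem _
  | cons k l ih =>
    obtain ⟨n, hn⟩ := h.lattice_int ih k
    have ha : a k ∈ AddSubgroup.closure (Set.range a) := AddSubgroup.subset_closure ⟨k, rfl⟩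
    have e : wd s (k :: l) (hsum Ψ) - hsum Ψ =
        (wd s l (hsum Ψ) - hsum Ψ) - n • a k - a k := by
      have h1 : wd s (k :: l) (hsum Ψ) = s k (wd s l (hsum Ψ) - hsum Ψ) + s k (hsum Ψ) := by
        rw [← map_add, sub_add_cancel, wd_cons]; rfl
      rw [h1, h.s_hsum, h.hs, hn, Int.cast_smul_eq_zsmul]
      abel
    rw [e]
    exact sub_mem (sub_mem ih (zsmul_mem ha n)) ha

theorem main [FiniteDimensional ℚ V] (h : PS B a c s Ψ)
    (hfin : ((Subgroup.closure (Set.range s) : Subgroup (V ≃ₗ[ℚ] V)) :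
      Set (V ≃ₗ[ℚ] V)).Finite) :
    ∑ w ∈ hfin.toFinset, AddMonoidAlgebra.single (w (hsum Ψ) - hsum Ψ) (sgn w) =
      ∏ α ∈ Ψ, (1 - expZ (-α)) := by
  have hLanti := fun k => h.sum_anti k hfin
  have hDanti := h.prod_anti
  obtain ⟨hD1, hD0⟩ := h.prod_supp Ψ subset_rfl
  set D := ∏ α ∈ Ψ, (1 - expZ (-α)) with hD
  set L := ∑ w ∈ hfin.toFinset, AddMonoidAlgebra.single (w (hsum Ψ) - hsum Ψ) (sgn w) with hL
  have hLc : ∀ ν, L.coeff ν =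
      ∑ w ∈ hfin.toFinset, if w (hsum Ψ) - hsum Ψ = ν then sgn w else 0 := by
    intro ν
    rw [hL, AddMonoidAlgebra.coeff_sum, Finsupp.finsetSum_apply]
    refine Finset.sum_congr rfl (fun w _ => ?_)
    rw [AddMonoidAlgebra.coeff_single, Finsupp.single_apply]
  have hL1 : ∀ ν, L.coeff ν ≠ 0 → ∃ l, wd s l (hsum Ψ) - hsum Ψ = ν := by
    intro ν hν
    rw [hLc] at hν
    obtain ⟨w, hw, hw2⟩ := Finset.exists_ne_zero_of_sum_ne_zero hν
    simp only [Set.Finite.mem_toFinset, SetLike.mem_coe] at hw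
    obtain ⟨l, rfl⟩ := h.exists_wd hw
    refine ⟨l, ?_⟩
    by_contra hne
    exact hw2 (if_neg hne)
  have hL0 : L.coeff 0 = 1 := by
    rw [hLc, Finset.sum_eq_single 1]
    · have h1 : ((1 : V ≃ₗ[ℚ] V) : V →ₗ[ℚ] V) = 1 := rfl
      have h2 : (1 : V ≃ₗ[ℚ] V) (hsum Ψ) - hsum Ψ = 0 := sub_self _
      rw [if_pos h2, sgn, h1, map_one, if_pos rfl]
    · intro w hw hne
      simp only [Set.Finite.mem_toFinset, SetLike.mem_coe] at hw
      obtain ⟨l, rfl⟩ := h.exists_wd hw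
      refine if_neg (fun e => hne (h.stab l (sub_eq_zero.1 e)))
    · intro h1
      exact absurd (by simp) h1
  have hanti : ∀ k ν, (L - D).coeff (s k (ν + hsum Ψ) - hsum Ψ) = - (L - D).coeff ν := by
    intro k ν
    apply h.coeff_anti
    rw [map_sub, mul_sub, hLanti, hDanti]; ring
  by_contra hne
  have hF : (L - D).coeff ≠ 0 := by
    intro e
    rw [AddMonoidAlgebra.coeff_eq_zero] at e
    exact hne (sub_eq_zero.1 e)
  obtain ⟨ν, hν, hmax⟩ := Finset.exists_max_image (L - D).coeff.support
    (fun ν => B ν (hsum Ψ)) (Finsupp.support_nonempty_iff.2 hF)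
  rw [Finsupp.mem_support_iff] at hν
  have hlat : ν ∈ AddSubgroup.closure (Set.range a) := by
    by_cases h1 : L.coeff ν = 0
    · have h2 : D.coeff ν ≠ 0 := by
        intro h2; apply hν
        rw [AddMonoidAlgebra.coeff_sub, Finsupp.sub_apply, h1, h2, sub_zero]
      have := cone_lattice (hD1 ν h2)
      rwa [neg_mem_iff] at this
    · obtain ⟨l, rfl⟩ := hL1 ν h1
      exact h.wd_lattice l
  have hdom : ∀ k, 0 ≤ B ν (a k) := by
    intro k
    have hpos := h.pos' k
    have hb := h.hBc k ν
    have hr := h.c_hsum k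
    have hbr := h.hBc k (hsum Ψ)
    rw [hr] at hbr
    have h1 := hmax (s k (ν + hsum Ψ) - hsum Ψ) (by
      rw [Finsupp.mem_support_iff, hanti]; exact neg_ne_zero.2 hν)
    have h2 : c k (ν + hsum Ψ) ≠ 0 := by
      intro e
      have h3 := hanti k ν
      rw [h.hs, e, zero_smul, sub_zero, add_sub_cancel_right] at h3
      apply hν; linarith
    obtain ⟨n, hn⟩ := h.lattice_int hlat k
    rw [map_add, hr, hn] at h2
    have h4 : s k (ν + hsum Ψ) - hsum Ψ = ν - (c k ν + 1) • a k := by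
      rw [h.hs, map_add, hr]; abel
    simp only [h4, map_sub, map_smul, LinearMap.sub_apply, LinearMap.smul_apply,
      smul_eq_mul, h.symm (a k)] at h1
    have h5 : 0 ≤ (c k ν + 1) * B (hsum Ψ) (a k) := by linarith
    have h6 : 0 ≤ c k ν + 1 := nonneg_of_mul_nonneg_left h5 (h.hsum_pos_simple k)
    rw [hn] at h6
    have h7 : (0 : ℤ) ≤ n + 1 := by exact_mod_cast h6
    have h8 : n + 1 ≠ 0 := by exact_mod_cast h2
    have h9 : (0 : ℚ) ≤ n := by
      have : (0 : ℤ) ≤ n := by omega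
      exact_mod_cast this
    rw [hn] at hb
    have := mul_nonneg h9 hpos.le
    linarith
  have hzero : ν = 0 := by
    by_contra hν0
    have hp := h.pos ν hν0
    by_cases h1 : L.coeff ν = 0
    · have h2 : D.coeff ν ≠ 0 := by
        intro h2; apply hν
        rw [AddMonoidAlgebra.coeff_sub, Finsupp.sub_apply, h1, h2, sub_zero]
      have := cone_nonneg hdom (hD1 ν h2)
      rw [map_neg] at this
      linarith
    · obtain ⟨l, hl⟩ := hL1 ν h1
      have e := h.wd_iso l (hsum Ψ) (hsum Ψ)
      have hl' : wd s l (hsum Ψ) = ν + hsum Ψ := by rw [← hl, sub_add_cancel]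
      rw [hl'] at e
      simp only [map_add, LinearMap.add_apply, h.symm (hsum Ψ) ν] at e
      have h3 : 0 ≤ B ν (hsum Ψ) := by
        rw [hsum, map_smul, map_sum, smul_eq_mul]
        refine mul_nonneg (by norm_num) (Finset.sum_nonneg fun α hα => ?_)
        exact cone_nonneg hdom (h.cone α hα)
      linarith
  apply hν
  rw [hzero, AddMonoidAlgebra.coeff_sub, Finsupp.sub_apply, hL0, hD0, sub_self]

end PS

theorem parabolic_weyl_denominator_formula
    {I V : Type*} [Fintype I] [DecidableEq I]
    [AddCommGroup V] [Module ℚ V] [FiniteDimensional ℚ V]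
    (Φ Φpos : Finset V) (sroot : I → V) (cpair : I → V →ₗ[ℚ] ℚ)
    (coeff : V → I → ℤ) (C : I → I → ℤ) (s : I → V ≃ₗ[ℚ] V)
    -- axioms of a reduced crystallographic root system with base:
    (hindep : LinearIndependent ℚ sroot)
    (hspan : Submodule.span ℚ (Set.range sroot) = ⊤)
    (hC : ∀ a b, (C a b : ℚ) = cpair a (sroot b))
    (hCdiag : ∀ a, C a a = 2)
    (hCoff : ∀ a b, a ≠ b → C a b ≤ 0)
    (hs : ∀ a v, s a v = v - cpair a v • sroot a)
    (hsimple : ∀ a, sroot a ∈ Φpos)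
    (hpossub : Φpos ⊆ Φ)
    (hzero : (0 : V) ∉ Φ)
    (hsymm : ∀ β ∈ Φ, -β ∈ Φ)
    (hsign : ∀ β ∈ Φ, β ∈ Φpos ∨ -β ∈ Φpos)
    (hcoeff : ∀ β ∈ Φ, β = ∑ b, coeff β b • sroot b)
    (hnonneg : ∀ β ∈ Φpos, ∀ b, 0 ≤ coeff β b)
    (hred : ∀ β ∈ Φ, ∀ t : ℚ, t • β ∈ Φ → t = 1 ∨ t = -1)
    (hsΦ : ∀ a, ∀ β ∈ Φ, s a β ∈ Φ)
    (hΦorbit : ∀ β ∈ Φ, ∃ w ∈ Subgroup.closure {g : V ≃ₗ[ℚ] V | ∃ b, g = s b},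
        ∃ b, β = w (sroot b))
    -- the Weyl vector:
    (ρ : V) (hρ : ρ = (2 : ℚ)⁻¹ • ∑ α ∈ Φpos, α)
    -- the parabolic subgroup `W_J`:
    (J : Finset I)
    (WJ : Subgroup (V ≃ₗ[ℚ] V))
    (hWJ : WJ = Subgroup.closure {g : V ≃ₗ[ℚ] V | ∃ b ∈ J, g = s b})
    (hfin : (WJ : Set (V ≃ₗ[ℚ] V)).Finite) :
    ∑ w ∈ hfin.toFinset, AddMonoidAlgebra.single (w ρ - ρ) (sgn w)
      = ∏ α ∈ Φpos.filter (fun α => ∀ b, b ∉ J → coeff α b = 0), (1 - expZ (-α)) := by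
  -- coordinates
  let bas : Module.Basis I ℚ V := Module.Basis.mk hindep hspan.ge
  have hbas : ∀ i, bas i = sroot i := fun i => Module.Basis.mk_apply hindep hspan.ge i
  have hcs : ∀ i j, bas.coord i (sroot j) = if j = i then 1 else 0 := by
    intro i j
    rw [← hbas j, Module.Basis.coord_apply, Module.Basis.repr_self, Finsupp.single_apply]
  have hco : ∀ β ∈ Φ, ∀ i, bas.coord i β = coeff β i := by
    intro β hβ i
    conv_lhs => rw [hcoeff β hβ]
    rw [map_sum]
    simp [map_zsmul, hcs]
  have hco0 : ∀ β ∈ Φpos, ∀ i, 0 ≤ bas.coord i β := by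
    intro β hβ i
    rw [hco β (hpossub hβ)]
    exact_mod_cast hnonneg β hβ i
  have hext : ∀ x y : V, (∀ i, bas.coord i x = bas.coord i y) → x = y := by
    intro x y hxy
    exact bas.ext_elem hxy
  have hne : ∀ β ∈ Φpos, β ≠ 0 := fun β hβ e => hzero (e ▸ hpossub hβ)
  have hneg : ∀ β ∈ Φpos, -β ∉ Φpos := by
    intro β hβ hβ'
    apply hne β hβ
    apply hext
    intro i
    have h1 := hco0 _ hβ i
    have h2 := hco0 _ hβ' i
    rw [map_neg] at h2
    rw [map_zero]; linarith
  have htwo : ∀ k, cpair k (sroot k) = 2 := by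
    intro k; rw [← hC, hCdiag]; norm_num
  have hsa : ∀ k, s k (sroot k) = - sroot k := by
    intro k; rw [hs, htwo, two_smul]; abel
  have hss : ∀ k v, s k (s k v) = v := by
    intro k v
    rw [hs k v, map_sub, map_smul, hsa, hs]
    module
  have hscoord : ∀ k i v, i ≠ k → bas.coord i (s k v) = bas.coord i v := by
    intro k i v hik
    rw [hs, map_sub, map_smul, hcs, if_neg (Ne.symm hik), smul_zero, sub_zero]
  have hperm : ∀ k, ∀ α ∈ Φpos, α ≠ sroot k → s k α ∈ Φpos := by
    intro k α hα hαk
    rcases hsign _ (hsΦ k α (hpossub hα)) with h1 | h1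
    · exact h1
    · exfalso
      have e : α = (bas.coord k α) • sroot k := by
        apply hext
        intro i
        rw [map_smul, hcs]
        split_ifs with hik
        · rw [hik]; simp
        · have h2 := hco0 _ hα i
          have h3 := hco0 _ h1 i
          rw [map_neg, hscoord k i α (Ne.symm hik)] at h3
          rw [smul_zero]; linarith
      have h4 := hpossub hα
      rw [e] at h4
      rcases hred _ (hpossub (hsimple k)) _ h4 with h5 | h5
      · apply hαk; rw [e, h5, one_smul]
      · have := hco0 _ hα k
        rw [h5] at this
        linarith
  have hpermE : ∀ k, ∀ α ∈ Φpos.erase (sroot k), s k α ∈ Φpos.erase (sroot k) := by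
    intro k α hα
    rw [Finset.mem_erase] at hα ⊢
    refine ⟨?_, hperm k α hα.2 hα.1⟩
    intro e
    have e2 := hss k α
    rw [e, hsa] at e2
    exact hneg _ (hsimple k) (e2 ▸ hα.2)
  have hsρ : ∀ k, s k ρ = ρ - sroot k := by
    intro k
    rw [hρ]
    exact PS.hsum_refl Φpos (s k) (sroot k) (hsimple k) (hsa k) (hss k) (hpermE k)
  -- the invariant form
  let B0 : V →ₗ[ℚ] V →ₗ[ℚ] ℚ :=
    ∑ i, (LinearMap.mul ℚ ℚ).compl₁₂ (bas.coord i) (bas.coord i)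
  have hB0 : ∀ x y, B0 x y = ∑ i, bas.coord i x * bas.coord i y := by
    intro x y
    simp [B0, LinearMap.sum_apply]
  let B : V →ₗ[ℚ] V →ₗ[ℚ] ℚ :=
    ∑ w ∈ hfin.toFinset, B0.compl₁₂ (w : V →ₗ[ℚ] V) (w : V →ₗ[ℚ] V)
  have hB : ∀ x y, B x y = ∑ w ∈ hfin.toFinset, B0 (w x) (w y) := by
    intro x y
    simp [B, LinearMap.sum_apply]
  have hBsymm : ∀ x y, B x y = B y x := by
    intro x y
    rw [hB, hB]
    refine Finset.sum_congr rfl fun w _ => ?_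
    rw [hB0, hB0]
    exact Finset.sum_congr rfl fun i _ => mul_comm _ _
  have hB0pos : ∀ x, x ≠ 0 → 0 < B0 x x := by
    intro x hx
    rw [hB0]
    have hn : ∀ i ∈ Finset.univ, 0 ≤ bas.coord i x * bas.coord i x :=
      fun i _ => mul_self_nonneg _
    refine lt_of_le_of_ne (Finset.sum_nonneg hn) (fun e => hx ?_)
    apply hext
    intro i
    have := (Finset.sum_eq_zero_iff_of_nonneg hn).1 e.symm i (Finset.mem_univ i)
    rw [map_zero]
    exact mul_self_eq_zero.1 this
  have hBpos : ∀ x, x ≠ 0 → 0 < B x x := by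
    intro x hx
    rw [hB]
    refine Finset.sum_pos (fun w _ => hB0pos _ ?_) ⟨1, by simp⟩
    simpa using hx
  have hBinv : ∀ g ∈ WJ, ∀ x y, B (g x) (g y) = B x y := by
    intro g hg x y
    rw [hB, hB]
    refine Finset.sum_nbij' (· * g) (· * g⁻¹) ?_ ?_ ?_ ?_ ?_
    · intro w hw
      simp only [Set.Finite.mem_toFinset, SetLike.mem_coe] at hw ⊢
      exact mul_mem hw hg
    · intro w hw
      simp only [Set.Finite.mem_toFinset, SetLike.mem_coe] at hw ⊢
      exact mul_mem hw (inv_mem hg)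
    · intro w _; simp
    · intro w _; simp
    · intro w _; rfl
  have hsW : ∀ k ∈ J, s k ∈ WJ := by
    intro k hk
    rw [hWJ]
    exact Subgroup.subset_closure ⟨k, hk, rfl⟩
  have hBc : ∀ k ∈ J, ∀ v, 2 * B v (sroot k) = cpair k v * B (sroot k) (sroot k) := by
    intro k hk v
    have e := hBinv (s k) (hsW k hk) v (sroot k)
    rw [hsa, hs] at e
    simp only [map_sub, map_neg, map_smul, LinearMap.sub_apply, LinearMap.smul_apply,
      smul_eq_mul] at e
    linarith
  set Ψ := Φpos.filter (fun α => ∀ b, b ∉ J → coeff α b = 0) with hΨ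
  have hΨmem : ∀ α, α ∈ Ψ ↔ α ∈ Φpos ∧ ∀ b, b ∉ J → bas.coord b α = 0 := by
    intro α
    rw [hΨ, Finset.mem_filter]
    refine and_congr_right fun hα => ?_
    refine forall_congr' fun b => ?_
    rw [hco α (hpossub hα)]
    norm_cast
  have hps : PS B (fun k : {b // b ∈ J} => sroot k) (fun k => cpair k) (fun k => s k) Ψ := by
    refine ⟨hBsymm, hBpos, fun k v => hs k v, fun k => htwo k, fun k v => hBc k k.2 v,
      fun k j => ⟨C k j, (hC k j).symm⟩, ?_, ?_, ?_, ?_, ?_⟩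
    · intro k
      rw [hΨmem]
      refine ⟨hsimple k, fun b hb => ?_⟩
      rw [hcs, if_neg]
      rintro rfl
      exact hb k.2
    · intro α hα
      exact hne α ((hΨmem α).1 hα).1
    · intro α hα
      have hα1 := (Finset.mem_filter.1 hα)
      rw [hcoeff α (hpossub hα1.1)]
      refine sum_mem fun b _ => ?_
      by_cases hb : b ∈ J
      · obtain ⟨n, hn⟩ := Int.eq_ofNat_of_zero_le (hnonneg α hα1.1 b)
        rw [hn, natCast_zsmul]
        have hm : sroot b ∈ AddSubmonoid.closure
            (Set.range fun k : {b // b ∈ J} => sroot k) :=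
          AddSubmonoid.subset_closure ⟨⟨b, hb⟩, rfl⟩
        exact nsmul_mem hm n
      · rw [hα1.2 b hb, zero_smul]
        exact zero_mem _
    · intro α hα hα'
      exact hneg α ((hΨmem α).1 hα).1 ((hΨmem _).1 hα').1
    · intro k α hα hαk
      rw [hΨmem] at hα ⊢
      refine ⟨hperm k α hα.1 hαk, fun b hb => ?_⟩
      rw [hscoord k b α, hα.2 b hb]
      rintro rfl
      exact hb k.2
  have hset : {g : V ≃ₗ[ℚ] V | ∃ b ∈ J, g = s b} =
      Set.range (fun k : {b // b ∈ J} => s k) := by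
    ext g
    constructor
    · rintro ⟨b, hb, rfl⟩; exact ⟨⟨b, hb⟩, rfl⟩
    · rintro ⟨⟨b, hb⟩, rfl⟩; exact ⟨b, hb, rfl⟩
  rw [hset] at hWJ
  clear_value Ψ
  subst hWJ
  rw [← hps.main hfin]
  refine Finset.sum_congr rfl fun w hw => ?_
  congr 1
  simp only [Set.Finite.mem_toFinset, SetLike.mem_coe] at hw
  have hfix : w (ρ - PS.hsum Ψ) = ρ - PS.hsum Ψ := by
    obtain ⟨l, rfl⟩ := hps.exists_wd hw
    clear hw
    induction l with
    | nil => rfl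
    | cons k l ih =>
      rw [PS.wd_cons]
      change s k (PS.wd _ l (ρ - PS.hsum Ψ)) = _
      rw [ih, map_sub, hsρ]
      have := hps.s_hsum k
      rw [this]
      abel
  rw [map_sub] at hfix
  rw [sub_eq_sub_iff_sub_eq_sub, hfix]
end

section
/- Let Φ be the root system of type F4, with simple roots labelled α_1, α_2, α_3, α_4 so that the Cartan matrix (C_{ab}) = (⟨α_b, α_a^∨⟩) is [[2,−1,0,0],[−1,2,−1,0],[0,−2,2,−1],[0,0,−1,2]] (Bourbaki numbering; α_1, α_2 long, α_3, α_4 short). Since the weight lattice of F4 equals the root lattice Q, the fundamental weights ω_a and the Weyl vector ρ lie in Q. Let W_{ω_4} be the parabolic subgroup of W generated by s_1, s_2, s_3 (the stabilizer of ω_4), and set S_4 := ∑_{w∈W_{ω_4}} det(w) · e^{w(ρ)} / (1 − e^{−w(2ω_4 − ω_1)}) ∈ K. Then S_4 · ∏_{α∈Φ⁺ : [α]_4 = 2} (1 − e^{−α}) = (1 − e^{−2ω_4}) · e^{ρ} · ∏_{α∈Φ⁺ : [α]_4 = 0} (1 − e^{−α}), an identity in K whose two sides in fact lie in ℤ[Q].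 -/
/-- `ℤ[Q]` (realized inside the group algebra `ℤ[V]`) is an integral domain. -/
instance addMonoidAlgebraIsDomain
    {V : Type*} [AddCommGroup V] [Module ℚ V] : IsDomain (AddMonoidAlgebra ℤ V) :=
  NoZeroDivisors.to_isDomain _

/-- The exponential `e^v`, viewed in the fraction field `K` of the group algebra. -/
noncomputable def expK {V : Type*} [AddCommGroup V] [Module ℚ V] (v : V) :
    FractionRing (AddMonoidAlgebra ℤ V) :=
  algebraMap (AddMonoidAlgebra ℤ V) _ (AddMonoidAlgebra.single v 1)

/-- Cartan matrix of type F4 (Bourbaki numbering: `α_1, α_2` long, `α_3, α_4` short),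
0-indexed, so node `i` of Bourbaki corresponds to index `i - 1`. -/
def cartanF4 : Matrix (Fin 4) (Fin 4) ℤ :=
  !![ 2, -1,  0,  0;
     -1,  2, -1,  0;
      0, -2,  2, -1;
      0,  0, -1,  2]

/-!
STATEMENT 8.  Let `Φ` be the root system of type F4.  With
`S_4 = ∑_{w ∈ W_{ω_4}} det(w) e^{w(ρ)} / (1 - e^{-w(2ω_4 - ω_1)})` in the fraction field
`K` of `ℤ[Q]`, where `W_{ω_4}` is the parabolic subgroup generated by `s_1, s_2, s_3`
(the stabilizer of `ω_4`), one has
`S_4 ⬝ ∏_{α ∈ Φ⁺, [α]_4 = 2} (1 - e^{-α})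
   = (1 - e^{-2ω_4}) ⬝ e^{ρ} ⬝ ∏_{α ∈ Φ⁺, [α]_4 = 0} (1 - e^{-α})`.
(Here node `4` of Bourbaki is index `3`, node `1` is index `0`.)
-/

namespace F4aux

/-- Coordinates with respect to half of the standard orthonormal basis. -/
abbrev Z4 := ℤ × ℤ × ℤ × ℤ

def cq (x : Z4) : Fin 4 → ℚ :=
  ![((x.1 : ℚ) + x.2.1) / 2, (2 * (x.1 : ℚ) + x.2.1 + x.2.2.1) / 2,
    (3 * (x.1 : ℚ) + x.2.1 + x.2.2.1 + x.2.2.2) / 2, (x.1 : ℚ)]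

def act : Fin 4 → Z4 → Z4
  | 0, (p, q, r, t) => (p, r, q, t)
  | 1, (p, q, r, t) => (p, q, t, r)
  | 2, (p, q, r, t) => (p, q, r, -t)
  | 3, (p, q, r, t) =>
    (p - (p - q - r - t) / 2, q + (p - q - r - t) / 2,
      r + (p - q - r - t) / 2, t + (p - q - r - t) / 2)

def simp4 : Fin 4 → Z4 := ![(0, 2, -2, 0), (0, 0, 2, -2), (0, 0, 0, 2), (1, -1, -1, -1)]

noncomputable def vv {V : Type*} [AddCommGroup V] [Module ℚ V] (sroot : Fin 4 → V) (x : Z4) : V :=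
  ∑ b, cq x b • sroot b

def actW (l : List (Fin 3)) (x : Z4) : Z4 := l.foldr (fun b y => act b.castSucc y) x

def cW : Fin 6 → List (Fin 3) := ![[], [0], [1, 0], [2, 1, 0], [1, 2, 1, 0], [0, 1, 2, 1, 0]]
def bW : Fin 4 → List (Fin 3) := ![[], [1], [2, 1], [1, 2, 1]]
def aW : Fin 2 → List (Fin 3) := ![[], [2]]
abbrev Idx := Fin 6 × Fin 4 × Fin 2
def wd (i : Idx) : List (Fin 3) := cW i.1 ++ (bW i.2.1 ++ aW i.2.2)

def roots : Finset Z4 :=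
  (({-2, -1, 0, 1, 2} : Finset ℤ) ×ˢ ({-2, -1, 0, 1, 2} : Finset ℤ) ×ˢ
    ({-2, -1, 0, 1, 2} : Finset ℤ) ×ˢ ({-2, -1, 0, 1, 2} : Finset ℤ)).filter
  (fun x => (x.1 % 2 = x.2.1 % 2 ∧ x.1 % 2 = x.2.2.1 % 2 ∧ x.1 % 2 = x.2.2.2 % 2) ∧
    (x.1 ^ 2 + x.2.1 ^ 2 + x.2.2.1 ^ 2 + x.2.2.2 ^ 2 = 4 ∨
     x.1 ^ 2 + x.2.1 ^ 2 + x.2.2.1 ^ 2 + x.2.2.2 ^ 2 = 8))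

def R2 : Finset Z4 := {(2, 0, 0, 0), (2, 2, 0, 0), (2, -2, 0, 0), (2, 0, 2, 0), (2, 0, -2, 0),
  (2, 0, 0, 2), (2, 0, 0, -2)}
def R0 : Finset Z4 := {(0, 2, 0, 0), (0, 0, 2, 0), (0, 0, 0, 2), (0, 2, 2, 0), (0, 2, -2, 0),
  (0, 2, 0, 2), (0, 2, 0, -2), (0, 0, 2, 2), (0, 0, 2, -2)}

def pos (x : Z4) : Prop := 0 ≤ x.1 + x.2.1 ∧ 0 ≤ 2 * x.1 + x.2.1 + x.2.2.1 ∧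
  0 ≤ 3 * x.1 + x.2.1 + x.2.2.1 + x.2.2.2 ∧ 0 ≤ x.1

instance (x : Z4) : Decidable (pos x) := by unfold pos; infer_instance

theorem roots_act : ∀ a, ∀ x ∈ roots, act a x ∈ roots := by decide +kernel
theorem roots_even : ∀ x ∈ roots, 2 ∣ x.1 - x.2.1 - x.2.2.1 - x.2.2.2 := by decide +kernel
theorem roots_simp : ∀ a, simp4 a ∈ roots := by decide +kernel
theorem roots_R2 : ∀ x ∈ roots, (x.1 = 2 → x ∈ R2) := by decide +kernel
theorem roots_R0 : ∀ x ∈ roots, (pos x → x.1 = 0 → x ∈ R0) := by decide +kernel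
theorem R2_roots : ∀ x ∈ R2, x ∈ roots ∧ pos x ∧ ¬ pos (-x) ∧ x.1 = 2 := by decide +kernel
theorem R0_roots : ∀ x ∈ R0, x ∈ roots ∧ pos x ∧ ¬ pos (-x) ∧ x.1 = 0 := by decide +kernel
theorem wd_inj : ∀ i j, actW (wd i) (0, 3, 2, 1) = actW (wd j) (0, 3, 2, 1) → i = j := by
  decide +kernel
theorem wd_closed : ∀ (b : Fin 3) (i : Idx), ∃ j : Idx, ∀ a, act b.castSucc (actW (wd i) (2 * simp4 a)) =
    actW (wd j) (2 * simp4 a) := by decide +kernel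

section
variable {V : Type*} [AddCommGroup V] [Module ℚ V]

theorem vv_inj {sroot : Fin 4 → V} (hindep : LinearIndependent ℚ sroot) {x y : Z4}
    (h : vv sroot x = vv sroot y) : x = y := by
  have h2 : ∑ b, (cq x b - cq y b) • sroot b = 0 := by
    simp only [sub_smul, Finset.sum_sub_distrib]
    exact sub_eq_zero.2 h
  have h3 := Fintype.linearIndependent_iff.1 hindep _ h2
  obtain ⟨p, q, r, t⟩ := x
  obtain ⟨p', q', r', t'⟩ := y
  have e0 := h3 0
  have e1 := h3 1
  have e2 := h3 2
  have e3 := h3 3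
  simp [cq] at e0 e1 e2 e3
  have f0 : (p : ℚ) = p' := by linarith
  have f1 : (q : ℚ) = q' := by linarith
  have f2 : (r : ℚ) = r' := by linarith
  have f3 : (t : ℚ) = t' := by linarith
  norm_cast at f0 f1 f2 f3
  subst f0 f1 f2 f3
  rfl

theorem vv_add (sroot : Fin 4 → V) (x y : Z4) : vv sroot (x + y) = vv sroot x + vv sroot y := by
  simp only [vv, ← Finset.sum_add_distrib, ← add_smul]
  refine Finset.sum_congr rfl fun b _ => ?_
  congr 1
  fin_cases b <;> simp [cq] <;> ring

theorem vv_neg (sroot : Fin 4 → V) (x : Z4) : vv sroot (-x) = - vv sroot x := by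
  simp only [vv, ← Finset.sum_neg_distrib, ← neg_smul]
  refine Finset.sum_congr rfl fun b _ => ?_
  congr 1
  fin_cases b <;> simp [cq] <;> ring

theorem vv_simp (sroot : Fin 4 → V) (a : Fin 4) : vv sroot (simp4 a) = sroot a := by
  fin_cases a <;> simp [vv, cq, simp4, Fin.sum_univ_four] <;> norm_num

theorem cpair_vv {sroot : Fin 4 → V} {cpair : Fin 4 → V →ₗ[ℚ] ℚ}
    (hc : ∀ a b, cpair a (sroot b) = (cartanF4 a b : ℚ)) (a : Fin 4) (x : Z4) :
    cpair a (vv sroot x) = (![((x.2.1 : ℚ) - x.2.2.1) / 2, ((x.2.2.1 : ℚ) - x.2.2.2) / 2, x.2.2.2,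
      ((x.1 : ℚ) - x.2.1 - x.2.2.1 - x.2.2.2) / 2] : Fin 4 → ℚ) a := by
  simp only [vv, Fin.sum_univ_four, map_add, map_smul, hc, smul_eq_mul]
  fin_cases a <;> simp [cq, cartanF4] <;> ring

theorem cpair_ext {sroot : Fin 4 → V} {cpair : Fin 4 → V →ₗ[ℚ] ℚ}
    (hspan : Submodule.span ℚ (Set.range sroot) = ⊤)
    (hc : ∀ a b, cpair a (sroot b) = (cartanF4 a b : ℚ)) {v w : V}
    (h : ∀ a, cpair a v = cpair a w) : v = w := by
  have hm : v - w ∈ Submodule.span ℚ (Set.range sroot) := by rw [hspan]; trivial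
  obtain ⟨c, hcv⟩ := (Submodule.mem_span_range_iff_exists_fun ℚ).1 hm
  have h' : ∀ a, cpair a (∑ i, c i • sroot i) = 0 := by
    intro a; rw [hcv, map_sub, h, sub_self]
  simp only [Fin.sum_univ_four, map_add, map_smul, hc, smul_eq_mul] at h'
  have e0 := h' 0
  have e1 := h' 1
  have e2 := h' 2
  have e3 := h' 3
  simp [cartanF4] at e0 e1 e2 e3
  have c0 : c 0 = 0 := by linarith
  have c1 : c 1 = 0 := by linarith
  have c2 : c 2 = 0 := by linarith
  have c3 : c 3 = 0 := by linarith
  simp [Fin.sum_univ_four, c0, c1, c2, c3] at hcv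
  exact sub_eq_zero.1 hcv.symm

theorem s_vv {sroot : Fin 4 → V} {cpair : Fin 4 → V →ₗ[ℚ] ℚ} {s : Fin 4 → V ≃ₗ[ℚ] V}
    (hc : ∀ a b, cpair a (sroot b) = (cartanF4 a b : ℚ))
    (hs : ∀ a v, s a v = v - cpair a v • sroot a) (a : Fin 4) (x : Z4)
    (hx : a = 3 → 2 ∣ x.1 - x.2.1 - x.2.2.1 - x.2.2.2) :
    s a (vv sroot x) = vv sroot (act a x) := by
  rw [hs, cpair_vv hc]
  obtain ⟨p, q, r, t⟩ := x
  fin_cases a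
  · simp [vv, cq, act, Fin.sum_univ_four]; module
  · simp [vv, cq, act, Fin.sum_univ_four]; module
  · simp [vv, cq, act, Fin.sum_univ_four]; module
  · obtain ⟨k, hk⟩ := hx rfl
    simp only at hk
    obtain rfl : p = 2 * k + q + r + t := by omega
    have : (2 * k + q + r + t - q - r - t) / 2 = k := by omega
    simp [vv, cq, act, Fin.sum_univ_four, this]; module

theorem word_vv {sroot : Fin 4 → V} {cpair : Fin 4 → V →ₗ[ℚ] ℚ} {s : Fin 4 → V ≃ₗ[ℚ] V}
    (hc : ∀ a b, cpair a (sroot b) = (cartanF4 a b : ℚ))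
    (hs : ∀ a v, s a v = v - cpair a v • sroot a) (l : List (Fin 3)) (x : Z4) :
    (l.map (fun b => s b.castSucc)).prod (vv sroot x) = vv sroot (actW l x) := by
  induction l with
  | nil => rfl
  | cons b l ih =>
    rw [List.map_cons, List.prod_cons, LinearEquiv.mul_apply, ih, s_vv hc hs]
    · rfl
    · intro h; exact absurd h (by revert b; decide)

theorem det_s [FiniteDimensional ℚ V]
    {sroot : Fin 4 → V} {cpair : Fin 4 → V →ₗ[ℚ] ℚ} {s : Fin 4 → V ≃ₗ[ℚ] V}
    (hindep : LinearIndependent ℚ sroot)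
    (hspan : Submodule.span ℚ (Set.range sroot) = ⊤)
    (hc : ∀ a b, cpair a (sroot b) = (cartanF4 a b : ℚ))
    (hs : ∀ a v, s a v = v - cpair a v • sroot a) (a : Fin 4) :
    LinearMap.det (s a : V →ₗ[ℚ] V) = -1 := by
  let b := Module.Basis.mk hindep hspan.ge
  have hb : ∀ i, b i = sroot i := fun i => by simp [b]
  rw [← LinearMap.det_toMatrix b]
  have : LinearMap.toMatrix b b (s a : V →ₗ[ℚ] V) = Matrix.of (fun i j =>
      (if i = j then (1 : ℚ) else 0) - (cartanF4 a j : ℚ) * (if i = a then 1 else 0)) := by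
    ext i j
    rw [LinearMap.toMatrix_apply]
    simp only [hb, LinearEquiv.coe_coe, hs, hc]
    rw [← hb, ← hb]
    simp [Finsupp.single_apply, eq_comm]
  rw [this]
  fin_cases a <;>
    simp [Matrix.det_succ_row_zero, Fin.sum_univ_succ, cartanF4, Fin.succAbove] <;> norm_num

theorem sgn_word [FiniteDimensional ℚ V]
    {sroot : Fin 4 → V} {cpair : Fin 4 → V →ₗ[ℚ] ℚ} {s : Fin 4 → V ≃ₗ[ℚ] V}
    (hindep : LinearIndependent ℚ sroot)
    (hspan : Submodule.span ℚ (Set.range sroot) = ⊤)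
    (hc : ∀ a b, cpair a (sroot b) = (cartanF4 a b : ℚ))
    (hs : ∀ a v, s a v = v - cpair a v • sroot a) (l : List (Fin 3)) :
    sgn (l.map (fun b => s b.castSucc)).prod = (-1) ^ l.length := by
  have h : LinearMap.det (((l.map (fun b => s b.castSucc)).prod : V ≃ₗ[ℚ] V) : V →ₗ[ℚ] V)
      = (-1) ^ l.length := by
    induction l with
    | nil => simpa using LinearMap.det_id
    | cons b l ih =>
      rw [List.map_cons, List.prod_cons, List.length_cons, pow_succ', ← ih,
        ← det_s hindep hspan hc hs b.castSucc, ← LinearMap.det_comp]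
      rfl
  rw [sgn, h]
  rcases neg_one_pow_eq_or ℚ l.length with h1 | h1
  · rw [if_pos h1]
    rcases Nat.even_or_odd l.length with h2 | h2
    · simp [h2.neg_one_pow]
    · rw [h2.neg_one_pow] at h1; norm_num at h1
  · rw [if_neg (by rw [h1]; norm_num)]
    rcases Nat.even_or_odd l.length with h2 | h2
    · rw [h2.neg_one_pow] at h1; norm_num at h1
    · simp [h2.neg_one_pow]

theorem expK_add (v w : V) : expK (v + w) = expK v * expK w := by
  simp [expK, ← map_mul, AddMonoidAlgebra.single_mul_single]

theorem expK_zero : expK (0 : V) = 1 := by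
  simp [expK, ← AddMonoidAlgebra.one_def]

theorem expK_inj {v w : V} (h : expK v = expK w) : v = w := by
  have := IsFractionRing.injective (AddMonoidAlgebra ℤ V) (FractionRing (AddMonoidAlgebra ℤ V)) h
  simpa [AddMonoidAlgebra.single_left_inj] using this

theorem expK_ne (v : V) : expK v ≠ 0 := by
  intro h
  have := expK_add v (-v)
  rw [h, add_neg_cancel, expK_zero] at this
  simp at this

theorem expK_neg (v : V) : expK (-v) = (expK v)⁻¹ := by
  refine eq_inv_of_mul_eq_one_left ?_
  rw [← expK_add, neg_add_cancel, expK_zero]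

theorem expK_nsmul (v : V) (n : ℕ) : expK (n • v) = expK v ^ n := by
  induction n with
  | zero => simp [expK_zero]
  | succ n ih => rw [succ_nsmul, expK_add, ih, pow_succ]

theorem expK_zsmul (v : V) (n : ℤ) : expK (n • v) = expK v ^ n := by
  cases n with
  | ofNat n => simpa using expK_nsmul v n
  | negSucc n =>
    rw [negSucc_zsmul, expK_neg, expK_nsmul, zpow_negSucc]

theorem expK_vv (sroot : Fin 4 → V) (x : Z4) : expK (vv sroot x) =
    expK (vv sroot (1, 0, 0, 0)) ^ x.1 * expK (vv sroot (0, 1, 0, 0)) ^ x.2.1 *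
    expK (vv sroot (0, 0, 1, 0)) ^ x.2.2.1 * expK (vv sroot (0, 0, 0, 1)) ^ x.2.2.2 := by
  simp only [← expK_zsmul, ← expK_add]
  congr 1
  obtain ⟨p, q, r, t⟩ := x
  simp only [← Int.cast_smul_eq_zsmul ℚ]
  simp [vv, cq, Fin.sum_univ_four]
  module

end

theorem delta_identity {K : Type*} [Field K] (v w : K) (hv : v ≠ 0) (hw : w ≠ 0) :
    v ^ 3 * w - v ^ 3 * w⁻¹ - v⁻¹ ^ 3 * w + v⁻¹ ^ 3 * w⁻¹
      - w ^ 3 * v + w ^ 3 * v⁻¹ + w⁻¹ ^ 3 * v - w⁻¹ ^ 3 * v⁻¹ =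
    (v - v⁻¹) * (w - w⁻¹) * ((v ^ 2 + v⁻¹ ^ 2) - (w ^ 2 + w⁻¹ ^ 2)) := by
  field_simp
  ring

theorem one_pair {K : Type*} [Field K] (t u : K) (hu : u ≠ 0)
    (k1 : ¬ 1 - t * u ^ 2 = 0) (k2 : ¬ 1 - t * u⁻¹ ^ 2 = 0) :
    (u ^ 5 * (1 - t * u ^ 2)⁻¹ - u⁻¹ ^ 5 * (1 - t * u⁻¹ ^ 2)⁻¹) *
      ((1 - t * u⁻¹ ^ 2) * (1 - t * u ^ 2)) =
    (u - u⁻¹) * ((u ^ 2 + u⁻¹ ^ 2) ^ 2 + (u ^ 2 + u⁻¹ ^ 2) - 1 - t * (u ^ 2 + u⁻¹ ^ 2 + 1)) := by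
  have e1 := mul_inv_cancel₀ k1
  have e2 := mul_inv_cancel₀ k2
  have e3 : (u ^ 5 * (1 - t * u ^ 2)⁻¹ - u⁻¹ ^ 5 * (1 - t * u⁻¹ ^ 2)⁻¹) *
      ((1 - t * u⁻¹ ^ 2) * (1 - t * u ^ 2)) =
      u ^ 5 * (1 - t * u⁻¹ ^ 2) - u⁻¹ ^ 5 * (1 - t * u ^ 2) := by
    generalize (1 - t * u ^ 2)⁻¹ = P at *
    generalize (1 - t * u⁻¹ ^ 2)⁻¹ = Q at *
    linear_combination u ^ 5 * (1 - t * u⁻¹ ^ 2) * e1 - u⁻¹ ^ 5 * (1 - t * u ^ 2) * e2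
  rw [e3]
  field_simp
  ring

theorem q_identity {K : Type*} [Field K] (t u : K) (hu : u ≠ 0) :
    (1 - t * u⁻¹ ^ 2) * (1 - t * u ^ 2) = 1 - t * (u ^ 2 + u⁻¹ ^ 2) + t ^ 2 := by
  field_simp
  ring

theorem rhs_identity {K : Type*} [Field K] (A B C : K) (hA : A ≠ 0) (hB : B ≠ 0) (hC : C ≠ 0) :
    A ^ 5 * B ^ 3 * C *
      ((1 - A⁻¹ ^ 2) * ((1 - B⁻¹ ^ 2) * ((1 - C⁻¹ ^ 2) * ((1 - A⁻¹ ^ 2 * B⁻¹ ^ 2) *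
        ((1 - A⁻¹ ^ 2 * B ^ 2) * ((1 - A⁻¹ ^ 2 * C⁻¹ ^ 2) * ((1 - A⁻¹ ^ 2 * C ^ 2) *
          ((1 - B⁻¹ ^ 2 * C⁻¹ ^ 2) * (1 - B⁻¹ ^ 2 * C ^ 2))))))))) =
    (A - A⁻¹) * (B - B⁻¹) * (C - C⁻¹) * (((A ^ 2 + A⁻¹ ^ 2) - (B ^ 2 + B⁻¹ ^ 2)) *
      ((A ^ 2 + A⁻¹ ^ 2) - (C ^ 2 + C⁻¹ ^ 2)) * ((B ^ 2 + B⁻¹ ^ 2) - (C ^ 2 + C⁻¹ ^ 2))) := by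
  field_simp
  ring

theorem pair_identity {K : Type*} [Field K] (t A B C : K) (hA : A ≠ 0) (hB : B ≠ 0) (hC : C ≠ 0)
    (k1 : ¬ 1 - t * A ^ 2 = 0) (k2 : ¬ 1 - t * A⁻¹ ^ 2 = 0)
    (k3 : ¬ 1 - t * B ^ 2 = 0) (k4 : ¬ 1 - t * B⁻¹ ^ 2 = 0)
    (k5 : ¬ 1 - t * C ^ 2 = 0) (k6 : ¬ 1 - t * C⁻¹ ^ 2 = 0) :
    (A ^ 5 * (B ^ 3 * C - B ^ 3 * C⁻¹ - B⁻¹ ^ 3 * C + B⁻¹ ^ 3 * C⁻¹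
        - C ^ 3 * B + C ^ 3 * B⁻¹ + C⁻¹ ^ 3 * B - C⁻¹ ^ 3 * B⁻¹) * (1 - t * A ^ 2)⁻¹
      - A⁻¹ ^ 5 * (B ^ 3 * C - B ^ 3 * C⁻¹ - B⁻¹ ^ 3 * C + B⁻¹ ^ 3 * C⁻¹
        - C ^ 3 * B + C ^ 3 * B⁻¹ + C⁻¹ ^ 3 * B - C⁻¹ ^ 3 * B⁻¹) * (1 - t * A⁻¹ ^ 2)⁻¹
      - B ^ 5 * (A ^ 3 * C - A ^ 3 * C⁻¹ - A⁻¹ ^ 3 * C + A⁻¹ ^ 3 * C⁻¹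
        - C ^ 3 * A + C ^ 3 * A⁻¹ + C⁻¹ ^ 3 * A - C⁻¹ ^ 3 * A⁻¹) * (1 - t * B ^ 2)⁻¹
      + B⁻¹ ^ 5 * (A ^ 3 * C - A ^ 3 * C⁻¹ - A⁻¹ ^ 3 * C + A⁻¹ ^ 3 * C⁻¹
        - C ^ 3 * A + C ^ 3 * A⁻¹ + C⁻¹ ^ 3 * A - C⁻¹ ^ 3 * A⁻¹) * (1 - t * B⁻¹ ^ 2)⁻¹
      + C ^ 5 * (A ^ 3 * B - A ^ 3 * B⁻¹ - A⁻¹ ^ 3 * B + A⁻¹ ^ 3 * B⁻¹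
        - B ^ 3 * A + B ^ 3 * A⁻¹ + B⁻¹ ^ 3 * A - B⁻¹ ^ 3 * A⁻¹) * (1 - t * C ^ 2)⁻¹
      - C⁻¹ ^ 5 * (A ^ 3 * B - A ^ 3 * B⁻¹ - A⁻¹ ^ 3 * B + A⁻¹ ^ 3 * B⁻¹
        - B ^ 3 * A + B ^ 3 * A⁻¹ + B⁻¹ ^ 3 * A - B⁻¹ ^ 3 * A⁻¹) * (1 - t * C⁻¹ ^ 2)⁻¹) *
      ((1 - t) * ((1 - t * A⁻¹ ^ 2) * ((1 - t * A ^ 2) * ((1 - t * B⁻¹ ^ 2) *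
        ((1 - t * B ^ 2) * ((1 - t * C⁻¹ ^ 2) * (1 - t * C ^ 2))))))) =
    (1 - t ^ 2) * (A ^ 5 * B ^ 3 * C *
      ((1 - A⁻¹ ^ 2) * ((1 - B⁻¹ ^ 2) * ((1 - C⁻¹ ^ 2) * ((1 - A⁻¹ ^ 2 * B⁻¹ ^ 2) *
        ((1 - A⁻¹ ^ 2 * B ^ 2) * ((1 - A⁻¹ ^ 2 * C⁻¹ ^ 2) * ((1 - A⁻¹ ^ 2 * C ^ 2) *
          ((1 - B⁻¹ ^ 2 * C⁻¹ ^ 2) * (1 - B⁻¹ ^ 2 * C ^ 2)))))))))) := by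
  rw [rhs_identity A B C hA hB hC, delta_identity B C hB hC, delta_identity A C hA hC,
    delta_identity A B hA hB]
  have pA := one_pair t A hA k1 k2
  have pB := one_pair t B hB k3 k4
  have pC := one_pair t C hC k5 k6
  have qA := q_identity t A hA
  have qB := q_identity t B hB
  have qC := q_identity t C hC
  generalize (1 - t * A ^ 2)⁻¹ = P1 at *
  generalize (1 - t * A⁻¹ ^ 2)⁻¹ = P2 at *
  generalize (1 - t * B ^ 2)⁻¹ = P3 at *
  generalize (1 - t * B⁻¹ ^ 2)⁻¹ = P4 at *
  generalize (1 - t * C ^ 2)⁻¹ = P5 at *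
  generalize (1 - t * C⁻¹ ^ 2)⁻¹ = P6 at *
  generalize 1 - t * A ^ 2 = D1 at *
  generalize 1 - t * A⁻¹ ^ 2 = D2 at *
  generalize 1 - t * B ^ 2 = D3 at *
  generalize 1 - t * B⁻¹ ^ 2 = D4 at *
  generalize 1 - t * C ^ 2 = D5 at *
  generalize 1 - t * C⁻¹ ^ 2 = D6 at *
  generalize A ^ 2 + A⁻¹ ^ 2 = a at *
  generalize B ^ 2 + B⁻¹ ^ 2 = b at *
  generalize C ^ 2 + C⁻¹ ^ 2 = c at *
  generalize A - A⁻¹ = x at *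
  generalize B - B⁻¹ = y at *
  generalize C - C⁻¹ = z at *
  have h : ((A ^ 5 * P1 - A⁻¹ ^ 5 * P2) * (D2 * D1) * (y * z * (b - c)) * (D4 * D3) * (D6 * D5) -
      (B ^ 5 * P3 - B⁻¹ ^ 5 * P4) * (D4 * D3) * (x * z * (a - c)) * (D2 * D1) * (D6 * D5) +
      (C ^ 5 * P5 - C⁻¹ ^ 5 * P6) * (D6 * D5) * (x * y * (a - b)) * (D2 * D1) * (D4 * D3)) * (1 - t)
      = (1 - t ^ 2) * (x * y * z * ((a - b) * (a - c) * (b - c))) := by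
    rw [pA, pB, pC, qA, qB, qC]
    ring
  linear_combination h

theorem reassoc {K : Type*} [Field K] {S P u a b c x R : K} (h : S * P = u * (a * b * c * R)) :
    x * S * P = u * (x * a * b * c) * R := by
  linear_combination x * h

def T {K : Type*} [Field K] (X u v w : K) : K :=
  u ^ 5 * (v ^ 3 * w - v ^ 3 * w⁻¹ - v⁻¹ ^ 3 * w + v⁻¹ ^ 3 * w⁻¹
      - w ^ 3 * v + w ^ 3 * v⁻¹ + w⁻¹ ^ 3 * v - w⁻¹ ^ 3 * v⁻¹) * (1 - X⁻¹ ^ 2 * u ^ 2)⁻¹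

theorem coset_sum {K : Type*} [Field K] (X A B C : K)
    (f : Z4 → K) (hf : ∀ x, f x = X ^ x.1 * A ^ x.2.1 * B ^ x.2.2.1 * C ^ x.2.2.2) (i : Fin 6) :
    (∑ j : Fin 4, ∑ k : Fin 2, (((-1) ^ (wd (i, j, k)).length : ℤ) •
      f (actW (wd (i, j, k)) (11, 5, 3, 1))) /
      (1 - f (-(actW (wd (i, j, k)) (2, -2, 0, 0))))) =
    X ^ 11 * (![T X A B C, - T X B A C, T X C A B, - T X C⁻¹ A B, T X B⁻¹ A C, - T X A⁻¹ B C] :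
      Fin 6 → K) i := by
  have e5 (u : K) : u ^ (5 : ℤ) = u ^ 5 := zpow_ofNat u 5
  have e3 (u : K) : u ^ (3 : ℤ) = u ^ 3 := zpow_ofNat u 3
  have e2 (u : K) : u ^ (2 : ℤ) = u ^ 2 := zpow_ofNat u 2
  have e11 (u : K) : u ^ (11 : ℤ) = u ^ 11 := zpow_ofNat u 11
  simp only [Fin.sum_univ_succ, Fin.sum_univ_zero]
  fin_cases i
  all_goals
    simp [wd, cW, bW, aW, actW, act, hf, e5, e3, e2, e11, div_eq_mul_inv, T]
    ring

theorem rat_identity {K : Type*} [Field K] (X A B C : K) (hX : X ≠ 0) (hA : A ≠ 0) (hB : B ≠ 0)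
    (hC : C ≠ 0) (f : Z4 → K) (hf : ∀ x, f x = X ^ x.1 * A ^ x.2.1 * B ^ x.2.2.1 * C ^ x.2.2.2)
    (h1 : ∀ x, x ≠ 0 → f x ≠ 1) :
    (∑ i : Idx, (((-1) ^ (wd i).length : ℤ) • f (actW (wd i) (11, 5, 3, 1))) /
      (1 - f (-(actW (wd i) (2, -2, 0, 0))))) * ∏ x ∈ R2, (1 - f (-x)) =
    (1 - f (-(4, 0, 0, 0))) * f (11, 5, 3, 1) * ∏ x ∈ R0, (1 - f (-x)) := by
  have hT : ∀ x : Z4, x ≠ 0 → (1 - f x) ≠ 0 := fun x hx h => h1 x hx (sub_eq_zero.1 h).symm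
  have hsum : (∑ i : Idx, (((-1) ^ (wd i).length : ℤ) • f (actW (wd i) (11, 5, 3, 1))) /
      (1 - f (-(actW (wd i) (2, -2, 0, 0))))) =
      X ^ 11 * (T X A B C - T X A⁻¹ B C - T X B A C + T X B⁻¹ A C + T X C A B - T X C⁻¹ A B) := by
    simp only [Fintype.sum_prod_type, coset_sum X A B C f hf, Fin.sum_univ_six]
    simp
    ring
  have k1 := hT (-2, 2, 0, 0) (by decide)
  have k2 := hT (-2, -2, 0, 0) (by decide)
  have k3 := hT (-2, 0, 2, 0) (by decide)
  have k4 := hT (-2, 0, -2, 0) (by decide)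
  have k5 := hT (-2, 0, 0, 2) (by decide)
  have k6 := hT (-2, 0, 0, -2) (by decide)
  have e2 (u : K) : u ^ (2 : ℤ) = u ^ 2 := zpow_ofNat u 2
  have e4 (u : K) : u ^ (4 : ℤ) = u ^ 4 := zpow_ofNat u 4
  rw [hsum]
  simp [hf, e2] at k1 k2 k3 k4 k5 k6
  simp [R2, R0, hf, e2]
  simp only [T]
  simp only [← inv_pow] at k1 k2 k3 k4 k5 k6 ⊢
  have hX4 : X⁻¹ ^ 4 = (X⁻¹ ^ 2) ^ 2 := by ring
  rw [hX4]
  generalize X⁻¹ ^ 2 = t at *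
  have key := pair_identity t A B C hA hB hC k1 k2 k3 k4 k5 k6
  exact reassoc key

end F4aux

open F4aux


theorem F4_node4_polyhedral_denominator_identity
    {V : Type*} [AddCommGroup V] [Module ℚ V] [FiniteDimensional ℚ V]
    (Φ Φpos : Finset V) (sroot : Fin 4 → V) (cpair : Fin 4 → V →ₗ[ℚ] ℚ)
    (coeff : V → Fin 4 → ℤ) (C : Fin 4 → Fin 4 → ℤ) (s : Fin 4 → V ≃ₗ[ℚ] V)
    -- axioms of a reduced crystallographic root system with base:
    (hindep : LinearIndependent ℚ sroot)
    (hspan : Submodule.span ℚ (Set.range sroot) = ⊤)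
    (hC : ∀ a b, (C a b : ℚ) = cpair a (sroot b))
    (hs : ∀ a v, s a v = v - cpair a v • sroot a)
    (hsimple : ∀ a, sroot a ∈ Φpos)
    (hpossub : Φpos ⊆ Φ)
    (hzero : (0 : V) ∉ Φ)
    (hsymm : ∀ β ∈ Φ, -β ∈ Φ)
    (hsign : ∀ β ∈ Φ, β ∈ Φpos ∨ -β ∈ Φpos)
    (hcoeff : ∀ β ∈ Φ, β = ∑ b, coeff β b • sroot b)
    (hnonneg : ∀ β ∈ Φpos, ∀ b, 0 ≤ coeff β b)
    (hred : ∀ β ∈ Φ, ∀ t : ℚ, t • β ∈ Φ → t = 1 ∨ t = -1)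
    (hsΦ : ∀ a, ∀ β ∈ Φ, s a β ∈ Φ)
    (hΦorbit : ∀ β ∈ Φ, ∃ w ∈ Subgroup.closure {g : V ≃ₗ[ℚ] V | ∃ b, g = s b},
        ∃ b, β = w (sroot b))
    -- `Φ` is of type F4 with the Bourbaki labelling:
    (hCmat : ∀ a b, C a b = cartanF4 a b)
    -- the fundamental weights and the Weyl vector (which lie in `Q` for F4):
    (ω : Fin 4 → V) (hω : ∀ a b, cpair b (ω a) = if a = b then 1 else 0)
    (ρ : V) (hρ : ρ = ∑ a, ω a)
    -- the parabolic subgroup `W_{ω_4}` generated by `s_1, s_2, s_3`: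
    (W4 : Subgroup (V ≃ₗ[ℚ] V))
    (hW4 : W4 = Subgroup.closure {g : V ≃ₗ[ℚ] V | ∃ b : Fin 4, b ≠ 3 ∧ g = s b})
    (hfin : (W4 : Set (V ≃ₗ[ℚ] V)).Finite) :
    (∑ w ∈ hfin.toFinset,
        sgn w • expK (w ρ) / (1 - expK (-(w ((2 : ℚ) • ω 3 - ω 0)))))
      * ∏ α ∈ Φpos.filter (fun α => coeff α 3 = 2), (1 - expK (-α))
    = (1 - expK (-((2 : ℚ) • ω 3))) * expK ρ
      * ∏ α ∈ Φpos.filter (fun α => coeff α 3 = 0), (1 - expK (-α)) := by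
  classical
  have hc : ∀ a b, cpair a (sroot b) = (cartanF4 a b : ℚ) := by
    intro a b; rw [← hC, hCmat]
  have hω3 : ω 3 = vv sroot (2, 0, 0, 0) := by
    apply cpair_ext hspan hc
    intro a; rw [hω, cpair_vv hc]; fin_cases a <;> simp
  have hω0 : ω 0 = vv sroot (2, 2, 0, 0) := by
    apply cpair_ext hspan hc
    intro a; rw [hω, cpair_vv hc]; fin_cases a <;> simp
  have hρ' : ρ = vv sroot (11, 5, 3, 1) := by
    apply cpair_ext hspan hc
    intro a; rw [hρ, map_sum, cpair_vv hc]; simp only [hω]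
    fin_cases a <;> simp [Fin.sum_univ_four] <;> norm_num
  have h2ω : (2 : ℚ) • ω 3 = vv sroot (4, 0, 0, 0) := by
    rw [hω3, two_smul, ← vv_add]; rfl
  have hμ : (2 : ℚ) • ω 3 - ω 0 = vv sroot (2, -2, 0, 0) := by
    rw [h2ω, hω0, sub_eq_add_neg, ← vv_neg, ← vv_add]; rfl
  -- the roots
  have hinv : ∀ a, (s a)⁻¹ = s a := by
    intro a
    rw [inv_eq_iff_mul_eq_one]
    ext v
    have h2 : cpair a (sroot a) = 2 := by
      rw [hc]; fin_cases a <;> simp [cartanF4]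
    simp only [LinearEquiv.mul_apply, hs, map_sub, map_smul, h2, smul_eq_mul]
    change _ = v
    module
  have hΦR : ∀ β ∈ Φ, ∃ x ∈ roots, β = vv sroot x := by
    intro β hβ
    obtain ⟨w, hw, b, rfl⟩ := hΦorbit β hβ
    have key : ∀ x ∈ roots, ∃ y ∈ roots, w (vv sroot x) = vv sroot y := by
      clear hβ
      induction hw using Subgroup.closure_induction_left with
      | one => exact fun x hx => ⟨x, hx, rfl⟩
      | mul_left g hg y hy ih =>
        obtain ⟨b, rfl⟩ := hg
        intro x hx
        obtain ⟨z, hz, hz'⟩ := ih x hx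
        exact ⟨act b z, roots_act b z hz, by
          rw [LinearEquiv.mul_apply, hz', s_vv hc hs _ _ fun _ => roots_even z hz]⟩
      | inv_mul_cancel g hg y hy ih =>
        obtain ⟨b, rfl⟩ := hg
        intro x hx
        obtain ⟨z, hz, hz'⟩ := ih x hx
        exact ⟨act b z, roots_act b z hz, by
          rw [hinv, LinearEquiv.mul_apply, hz', s_vv hc hs _ _ fun _ => roots_even z hz]⟩
    obtain ⟨y, hy, h⟩ := key _ (roots_simp b)
    exact ⟨y, hy, by rw [← h, vv_simp]⟩
  have hco : ∀ x, vv sroot x ∈ Φ → ∀ b, (coeff (vv sroot x) b : ℚ) = cq x b := by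
    intro x hx b
    have h := hcoeff _ hx
    have h2 : ∑ b, ((coeff (vv sroot x) b : ℚ) - cq x b) • sroot b = 0 := by
      simp only [sub_smul, Finset.sum_sub_distrib, Int.cast_smul_eq_zsmul]
      exact sub_eq_zero.2 h.symm
    exact sub_eq_zero.1 (Fintype.linearIndependent_iff.1 hindep _ h2 b)
  have hco3 : ∀ x, vv sroot x ∈ Φ → coeff (vv sroot x) 3 = x.1 := by
    intro x hx
    have := hco x hx 3
    simp [cq] at this
    exact_mod_cast this
  have hpos : ∀ x, vv sroot x ∈ Φpos → pos x := by
    intro x hx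
    have h : ∀ b, (0 : ℚ) ≤ cq x b := by
      intro b; rw [← hco x (hpossub hx)]; exact_mod_cast hnonneg _ hx b
    have e0 := h 0
    have e1 := h 1
    have e2 := h 2
    have e3 := h 3
    simp only [cq] at e0 e1 e2 e3
    simp at e0 e1 e2 e3
    have f0 : (0 : ℚ) ≤ x.1 + x.2.1 := by linarith
    have f1 : (0 : ℚ) ≤ 2 * x.1 + x.2.1 + x.2.2.1 := by linarith
    have f2 : (0 : ℚ) ≤ 3 * x.1 + x.2.1 + x.2.2.1 + x.2.2.2 := by linarith
    exact ⟨by exact_mod_cast f0, by exact_mod_cast f1, by exact_mod_cast f2, by exact_mod_cast e3⟩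
  have hstep : ∀ a x y, vv sroot x ∈ Φ → x ∈ roots → act a x = y → vv sroot y ∈ Φ := by
    rintro a x y hx hr rfl
    rw [← s_vv hc hs a x fun _ => roots_even x hr]
    exact hsΦ a _ hx
  have hsim : ∀ a x, simp4 a = x → vv sroot x ∈ Φ := by
    rintro a x rfl
    rw [vv_simp]; exact hpossub (hsimple a)
  have hR0Φ : ∀ x ∈ R0, vv sroot x ∈ Φ := by
    have a0 := hsim 0 (0, 2, -2, 0) (by decide)
    have a1 := hsim 1 (0, 0, 2, -2) (by decide)
    have a2 := hsim 2 (0, 0, 0, 2) (by decide)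
    have a3 := hstep 1 _ (0, 0, 2, 0) a2 (by decide +kernel) (by decide)
    have a4 := hstep 0 _ (0, 2, 0, 0) a3 (by decide +kernel) (by decide)
    have a5 := hstep 2 _ (0, 0, 2, 2) a1 (by decide +kernel) (by decide)
    have a6 := hstep 0 _ (0, 2, 0, 2) a5 (by decide +kernel) (by decide)
    have a7 := hstep 0 _ (0, 2, 0, -2) a1 (by decide +kernel) (by decide)
    have a8 := hstep 1 _ (0, 2, 2, 0) a6 (by decide +kernel) (by decide)
    intro x hx
    simp only [R0, Finset.mem_insert, Finset.mem_singleton] at hx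
    rcases hx with rfl | rfl | rfl | rfl | rfl | rfl | rfl | rfl | rfl <;> assumption
  have hR2Φ : ∀ x ∈ R2, vv sroot x ∈ Φ := by
    have a3 := hsim 3 (1, -1, -1, -1) (by decide)
    have b1 := hstep 2 _ (1, -1, -1, 1) a3 (by decide +kernel) (by decide)
    have b2 := hstep 1 _ (1, -1, 1, -1) b1 (by decide +kernel) (by decide)
    have b3 := hstep 2 _ (1, -1, 1, 1) b2 (by decide +kernel) (by decide)
    have b4 := hstep 0 _ (1, 1, -1, 1) b3 (by decide +kernel) (by decide)
    have b5 := hstep 1 _ (1, 1, 1, -1) b4 (by decide +kernel) (by decide)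
    have b6 := hstep 2 _ (1, 1, 1, 1) b5 (by decide +kernel) (by decide)
    have c0 := hstep 3 _ (2, 0, 0, 0) b6 (by decide +kernel) (by decide)
    have d0 := hR0Φ (0, 2, 2, 0) (by decide)
    have d1 := hstep 3 _ (2, 0, 0, -2) d0 (by decide +kernel) (by decide)
    have d2 := hstep 2 _ (2, 0, 0, 2) d1 (by decide +kernel) (by decide)
    have d3 := hstep 1 _ (2, 0, 2, 0) d2 (by decide +kernel) (by decide)
    have d4 := hstep 0 _ (2, 2, 0, 0) d3 (by decide +kernel) (by decide)
    have d5 := hstep 1 _ (2, 0, -2, 0) d1 (by decide +kernel) (by decide)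
    have d6 := hstep 0 _ (2, -2, 0, 0) d5 (by decide +kernel) (by decide)
    intro x hx
    simp only [R2, Finset.mem_insert, Finset.mem_singleton] at hx
    rcases hx with rfl | rfl | rfl | rfl | rfl | rfl | rfl <;> assumption
  have hnp : ∀ x, vv sroot x ∈ Φ → ¬ pos (-x) → vv sroot x ∈ Φpos := by
    intro x hx hn
    rcases hsign _ hx with h | h
    · exact h
    · rw [← vv_neg] at h; exact absurd (hpos _ h) hn
  have hF2 : Φpos.filter (fun α => coeff α 3 = 2) = R2.image (vv sroot) := by
    ext β
    simp only [Finset.mem_filter, Finset.mem_image]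
    constructor
    · rintro ⟨h1, h2⟩
      obtain ⟨x, hx, rfl⟩ := hΦR β (hpossub h1)
      rw [hco3 x (hpossub h1)] at h2
      exact ⟨x, roots_R2 x hx h2, rfl⟩
    · rintro ⟨x, hx, rfl⟩
      obtain ⟨h1, h2, h3, h4⟩ := R2_roots x hx
      exact ⟨hnp x (hR2Φ x hx) h3, by rw [hco3 x (hR2Φ x hx), h4]⟩
  have hF0 : Φpos.filter (fun α => coeff α 3 = 0) = R0.image (vv sroot) := by
    ext β
    simp only [Finset.mem_filter, Finset.mem_image]
    constructor
    · rintro ⟨h1, h2⟩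
      obtain ⟨x, hx, rfl⟩ := hΦR β (hpossub h1)
      rw [hco3 x (hpossub h1)] at h2
      exact ⟨x, roots_R0 x hx (hpos x h1) h2, rfl⟩
    · rintro ⟨x, hx, rfl⟩
      obtain ⟨h1, h2, h3, h4⟩ := R0_roots x hx
      exact ⟨hnp x (hR0Φ x hx) h3, by rw [hco3 x (hR0Φ x hx), h4]⟩
  -- the parabolic subgroup
  let g : Idx → (V ≃ₗ[ℚ] V) := fun i => ((wd i).map (fun b => s b.castSucc)).prod
  have hgv : ∀ i x, g i (vv sroot x) = vv sroot (actW (wd i) x) := fun i x => word_vv hc hs _ x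
  have hginj : Function.Injective g := by
    intro i j h
    apply wd_inj
    apply vv_inj hindep
    rw [← hgv, ← hgv, h]
  have hcl : ∀ (b : Fin 3) (i : Idx), ∃ j, s b.castSucc * g i = g j := by
    intro b i
    obtain ⟨j, hj⟩ := wd_closed b i
    refine ⟨j, ?_⟩
    apply LinearEquiv.toLinearMap_injective
    refine LinearMap.ext_on_range hspan fun a => ?_
    have h2 : sroot a = (1 / 2 : ℚ) • vv sroot (2 * simp4 a) := by
      rw [two_mul, vv_add, vv_simp]; module
    rw [h2, map_smul, map_smul]
    congr 1
    rw [LinearEquiv.coe_coe, LinearEquiv.coe_coe, hgv, LinearEquiv.mul_apply, hgv, s_vv hc hs, hj]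
    intro h; exact absurd h (by clear hj; revert b; decide)
  have hW : hfin.toFinset = Finset.univ.image g := by
    ext w
    simp only [Set.Finite.mem_toFinset, SetLike.mem_coe, Finset.mem_image, Finset.mem_univ, true_and]
    constructor
    · intro hw
      rw [hW4] at hw
      have hlt : ∀ b : Fin 4, b ≠ 3 → ∃ b' : Fin 3, b = b'.castSucc := by decide
      induction hw using Subgroup.closure_induction_left with
      | one => exact ⟨(0, 0, 0), rfl⟩
      | mul_left x hx y hy ih =>
        obtain ⟨b, hb, rfl⟩ := hx
        obtain ⟨i, rfl⟩ := ih
        obtain ⟨b, rfl⟩ := hlt b hb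
        obtain ⟨j, hj⟩ := hcl b i
        exact ⟨j, hj.symm⟩
      | inv_mul_cancel x hx y hy ih =>
        obtain ⟨b, hb, rfl⟩ := hx
        obtain ⟨i, rfl⟩ := ih
        obtain ⟨b, rfl⟩ := hlt b hb
        obtain ⟨j, hj⟩ := hcl b i
        exact ⟨j, by rw [hinv]; exact hj.symm⟩
    · rintro ⟨i, rfl⟩
      apply Subgroup.list_prod_mem
      intro x hx
      obtain ⟨b, -, rfl⟩ := List.mem_map.1 hx
      rw [hW4]
      exact Subgroup.subset_closure ⟨b.castSucc, by clear hx; revert b; decide, rfl⟩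
  have hvi : Function.Injective (vv sroot) := fun x y h => vv_inj hindep h
  rw [hF2, hF0, hW, Finset.prod_image hvi.injOn, Finset.prod_image hvi.injOn,
    Finset.sum_image hginj.injOn, hμ, h2ω, hρ']
  have hsg : ∀ i, sgn (g i) = (-1) ^ (wd i).length := fun i => sgn_word hindep hspan hc hs _
  simp only [hsg, hgv, ← vv_neg]
  refine rat_identity (expK (vv sroot (1, 0, 0, 0))) (expK (vv sroot (0, 1, 0, 0)))
    (expK (vv sroot (0, 0, 1, 0))) (expK (vv sroot (0, 0, 0, 1))) (expK_ne _) (expK_ne _)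
    (expK_ne _) (expK_ne _) (fun x => expK (vv sroot x)) (expK_vv sroot) ?_
  intro x hx h
  apply hx
  apply hvi
  have h0 : vv sroot (0 : Z4) = 0 := by simp [vv, cq, Fin.sum_univ_four]
  rw [h0]
  exact expK_inj (h.trans expK_zero.symm)
end

section
/- Let Φ be the root system of type E8, with simple roots labelled so that the Dynkin diagram is the chain α_1–α_2–α_3–α_4–α_5–α_6–α_7 with α_8 attached to α_3 (so the coefficients of the highest root θ are ([θ]_1,…,[θ]_8) = (2,4,6,5,4,3,2,3), θ = ω_7, and node 1 is the unique node with [θ]_1 = 2 and ⟨θ, α_1^∨⟩ = 0). Since the weight lattice of E8 equals the root lattice Q, the fundamental weights ω_a and the Weyl vector ρ lie in Q. Let W_{ω_1} be the parabolic subgroup of W generated by {s_b : b ∈ {2,3,4,5,6,7,8}} (the stabilizer of ω_1, of type D7), and set S_1 := ∑_{w∈W_{ω_1}} det(w) · e^{w(ρ)} / (1 − e^{−w(ω_1 − ω_7)}) ∈ K. Then S_1 · ∏_{α∈Φ⁺ : [α]_1 = 2} (1 − e^{−α}) = (1 − e^{−ω_1}) · e^{ρ} · ∏_{α∈Φ⁺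 : [α]_1 = 0} (1 − e^{−α}), an identity in K whose two sides in fact lie in ℤ[Q]. -/
/-- Cartan matrix of type E8, labelled as in the paper: the Dynkin diagram is the chain
`1–2–3–4–5–6–7` with node `8` attached to node `3`; 0-indexed, so node `i` corresponds
to index `i - 1`. -/
def cartanE8 : Matrix (Fin 8) (Fin 8) ℤ :=
  !![ 2, -1,  0,  0,  0,  0,  0,  0;
     -1,  2, -1,  0,  0,  0,  0,  0;
      0, -1,  2, -1,  0,  0,  0, -1;
      0,  0, -1,  2, -1,  0,  0,  0;
      0,  0,  0, -1,  2, -1,  0,  0;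
      0,  0,  0,  0, -1,  2, -1,  0;
      0,  0,  0,  0,  0, -1,  2,  0;
      0,  0, -1,  0,  0,  0,  0,  2]

set_option linter.constructorNameAsVariable false


/-- symmetric power sums `x^k + x^{-k}` -/
def TT {K : Type*} [Field K] (x : K) (k : ℕ) : K := x ^ k + x⁻¹ ^ k

lemma det_TT {K : Type*} [Field K] (X : Fin 7 → K) (hX : ∀ j, X j ≠ 0) :
    (Matrix.of fun j i : Fin 7 => TT (X j) (6 - (i : ℕ))).det =
      2 * ∏ i : Fin 7, ∏ j ∈ Finset.Ioi i, ((X i - X j) * (1 - (X i)⁻¹ * (X j)⁻¹)) := by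
  have h1 : (Matrix.of fun j i : Fin 7 => TT (X j) (6 - (i : ℕ))) =
      (Matrix.of fun j i : Fin 7 => (X j + (X j)⁻¹) ^ (6 - (i : ℕ))) *
      !![1, 0, 0, 0, 0, 0, 0;
         0, 1, 0, 0, 0, 0, 0;
         -6, 0, 1, 0, 0, 0, 0;
         0, -5, 0, 1, 0, 0, 0;
         9, 0, -4, 0, 1, 0, 0;
         0, 5, 0, -3, 0, 1, 0;
         -2, 0, 2, 0, -2, 0, 2] := by
    ext j i
    have := hX j
    rw [Matrix.mul_apply]
    fin_cases i <;> simp [Fin.sum_univ_succ, TT] <;> field_simp <;> ring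
  rw [h1, Matrix.det_mul, mul_comm]
  congr 1
  · rw [Matrix.det_of_isLowerTriangular]
    · simp [Fin.prod_univ_succ]
    · intro i j hij
      fin_cases i <;> fin_cases j <;> first | rfl | (exfalso; revert hij; decide)
  · have h2 : (Matrix.of fun j i : Fin 7 => (X j + (X j)⁻¹) ^ (6 - (i : ℕ))) =
      Matrix.projVandermonde 1 (fun j => X j + (X j)⁻¹) := by
      ext j i
      rw [Matrix.projVandermonde_apply]
      simp only [Matrix.of_apply, Pi.one_apply, one_pow, one_mul, Fin.val_rev]
      congr 1
      omega
    rw [h2, Matrix.det_projVandermonde]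
    refine Finset.prod_congr rfl fun i _ => Finset.prod_congr rfl fun j _ => ?_
    have := hX i
    have := hX j
    simp only [Pi.one_apply, one_mul]
    field_simp
    ring

lemma det_tri {K : Type*} [Field K] (y : K) : 
    (!![1, -y, 0, 0, 0, 0, 0;
        -y, 1+y^2, -y, 0, 0, 0, 0;
        0, -y, 1+y^2, -y, 0, 0, 0;
        0, 0, -y, 1+y^2, -y, 0, 0;
        0, 0, 0, -y, 1+y^2, -y, 0;
        0, 0, 0, 0, -y, 1+y^2, -2*y;
        0, 0, 0, 0, 0, -y, 1+y^2] : Matrix (Fin 7) (Fin 7) K).det = 1 - y^2 := by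
  have h : (!![1, -y, 0, 0, 0, 0, 0;
        -y, 1+y^2, -y, 0, 0, 0, 0;
        0, -y, 1+y^2, -y, 0, 0, 0;
        0, 0, -y, 1+y^2, -y, 0, 0;
        0, 0, 0, -y, 1+y^2, -y, 0;
        0, 0, 0, 0, -y, 1+y^2, -2*y;
        0, 0, 0, 0, 0, -y, 1+y^2] : Matrix (Fin 7) (Fin 7) K) =
      !![1, 0, 0, 0, 0, 0, 0;
        -y, 1, 0, 0, 0, 0, 0;
        0, -y, 1, 0, 0, 0, 0;
        0, 0, -y, 1, 0, 0, 0;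
        0, 0, 0, -y, 1, 0, 0;
        0, 0, 0, 0, -y, 1, 0;
        0, 0, 0, 0, 0, -y, 1] *
      !![1, -y, 0, 0, 0, 0, 0;
        0, 1, -y, 0, 0, 0, 0;
        0, 0, 1, -y, 0, 0, 0;
        0, 0, 0, 1, -y, 0, 0;
        0, 0, 0, 0, 1, -y, 0;
        0, 0, 0, 0, 0, 1, -2*y;
        0, 0, 0, 0, 0, 0, 1-y^2] := by
    ext i j
    rw [Matrix.mul_apply]
    fin_cases i <;> fin_cases j <;> simp [Fin.sum_univ_succ] <;> ring
  rw [h, Matrix.det_mul, Matrix.det_of_isLowerTriangular, Matrix.det_of_isUpperTriangular]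
  · simp [Fin.prod_univ_succ]
  · intro i j hij
    fin_cases i <;> fin_cases j <;> first | rfl | (exfalso; revert hij; decide)
  · intro i j hij
    fin_cases i <;> fin_cases j <;> first | rfl | (exfalso; revert hij; decide)

lemma det_M {K : Type*} [Field K] (X : Fin 7 → K) (hX : ∀ j, X j ≠ 0) (y : K)
    (h1 : ∀ j, 1 - y * X j ≠ 0) (h2 : ∀ j, 1 - y * (X j)⁻¹ ≠ 0) :
    (Matrix.of fun j i : Fin 7 => if i = 0 then X j ^ 6 / (1 - y * X j)
        + (X j)⁻¹ ^ 6 / (1 - y * (X j)⁻¹) else TT (X j) (6 - (i : ℕ))).det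
      * ∏ j, ((1 - y * X j) * (1 - y * (X j)⁻¹)) =
      2 * (1 - y ^ 2) * ∏ i : Fin 7, ∏ j ∈ Finset.Ioi i,
        ((X i - X j) * (1 - (X i)⁻¹ * (X j)⁻¹)) := by
  rw [mul_comm, ← Matrix.det_mul_column, mul_right_comm, ← det_TT X hX, ← det_tri y,
    ← Matrix.det_mul]
  congr 1
  ext j i
  have a := hX j
  have b := h1 j
  have c := h2 j
  have d : X j ^ 6 / (1 - y * X j) + (X j)⁻¹ ^ 6 / (1 - y * (X j)⁻¹) =
    (X j ^ 6 * (1 - y * (X j)⁻¹) + (X j)⁻¹ ^ 6 * (1 - y * X j)) / ((1 - y * X j) * (1 - y * (X j)⁻¹)) := by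
    rw [div_add_div _ _ b c]; ring
  rw [Matrix.mul_apply]
  have e : (1 - y * X j) * (1 - y * (X j)⁻¹) ≠ 0 := mul_ne_zero b c
  fin_cases i
  · simp only [Matrix.of_apply, Fin.zero_eta, if_true, d]
    rw [mul_div_cancel₀ _ e]
    simp [Fin.sum_univ_succ, TT]
    field_simp
    ring
  all_goals
    simp [Fin.sum_univ_succ, TT]
    field_simp
    ring

section SignedPerm

open Module

variable {V : Type*} [AddCommGroup V] [Module ℚ V]

/-- The even-type signed permutation `e_i ↦ η_i e_{σ i}`, `δ ↦ δ`. -/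
noncomputable def sp (bs : Basis (Option (Fin 7)) ℚ V) (σ : Equiv.Perm (Fin 7))
    (η : Fin 7 → ℤˣ) : V ≃ₗ[ℚ] V :=
  bs.equiv (bs.unitsSMul (fun o => o.elim 1 (fun i => Units.map (Int.castRingHom ℚ) (η (σ.symm i)))))
    (Equiv.optionCongr σ)

lemma sp_none (bs : Basis (Option (Fin 7)) ℚ V) (σ : Equiv.Perm (Fin 7)) (η : Fin 7 → ℤˣ) :
    sp bs σ η (bs none) = bs none := by
  simp [sp, Basis.equiv_apply, Basis.unitsSMul_apply]

lemma sp_some (bs : Basis (Option (Fin 7)) ℚ V) (σ : Equiv.Perm (Fin 7)) (η : Fin 7 → ℤˣ)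
    (i : Fin 7) :
    sp bs σ η (bs (some i)) = (((η i : ℤˣ) : ℤ) : ℚ) • bs (some (σ i)) := by
  simp [sp, Basis.equiv_apply, Basis.unitsSMul_apply, Units.smul_def]

lemma sp_ext (bs : Basis (Option (Fin 7)) ℚ V) (σ : Equiv.Perm (Fin 7)) (η : Fin 7 → ℤˣ)
    (w : V ≃ₗ[ℚ] V) (h0 : w (bs none) = bs none)
    (h : ∀ i, w (bs (some i)) = (((η i : ℤˣ) : ℤ) : ℚ) • bs (some (σ i))) : w = sp bs σ η := by
  apply LinearEquiv.toLinearMap_injective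
  apply bs.ext
  rintro (_ | i)
  · simp [h0, sp_none]
  · simp [h, sp_some]

lemma sp_mul (bs : Basis (Option (Fin 7)) ℚ V) (σ τ : Equiv.Perm (Fin 7)) (η ζ : Fin 7 → ℤˣ) :
    sp bs σ η * sp bs τ ζ = sp bs (σ * τ) (fun i => ζ i * η (τ i)) := by
  apply sp_ext
  · simp [LinearEquiv.mul_apply, sp_none]
  · intro i
    simp [LinearEquiv.mul_apply, sp_some, mul_smul]

lemma sp_one (bs : Basis (Option (Fin 7)) ℚ V) : sp bs 1 1 = 1 := by
  symm
  apply sp_ext <;> simp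

lemma sp_inj (bs : Basis (Option (Fin 7)) ℚ V) (σ τ : Equiv.Perm (Fin 7)) (η ζ : Fin 7 → ℤˣ)
    (h : sp bs σ η = sp bs τ ζ) : σ = τ ∧ η = ζ := by
  have key : ∀ i, σ i = τ i ∧ η i = ζ i := by
    intro i
    have h1 : sp bs σ η (bs (some i)) = sp bs τ ζ (bs (some i)) := by rw [h]
    rw [sp_some, sp_some] at h1
    have h2 := congrArg (fun v => bs.repr v (some (σ i))) h1
    simp [Finsupp.single_apply] at h2
    by_cases hst : τ i = σ i
    · simp [hst] at h2
      exact ⟨hst.symm, Units.ext h2⟩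
    · simp [hst] at h2
  exact ⟨Equiv.ext fun i => (key i).1, funext fun i => (key i).2⟩

lemma det_sp (bs : Basis (Option (Fin 7)) ℚ V) (σ : Equiv.Perm (Fin 7)) (η : Fin 7 → ℤˣ) :
    LinearMap.det (sp bs σ η : V →ₗ[ℚ] V)
      = ((Equiv.Perm.sign σ : ℤ) : ℚ) * (((∏ i, η i : ℤˣ) : ℤ) : ℚ) := by
  rw [← LinearMap.det_toMatrix bs]
  have h : LinearMap.toMatrix bs bs (sp bs σ η : V →ₗ[ℚ] V) =
      (Equiv.Perm.permMatrix ℚ (Equiv.optionCongr σ⁻¹)) *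
        Matrix.diagonal (fun o : Option (Fin 7) => o.elim (1 : ℚ) (fun i => ((η i : ℤ) : ℚ))) := by
    ext o o'
    rw [Matrix.mul_diagonal, LinearMap.toMatrix_apply]
    rcases o' with _ | i
    · simp [sp_none, Equiv.Perm.permMatrix, PEquiv.toMatrix_apply, Finsupp.single_apply]
      rcases o with _ | j <;> simp
    · simp [sp_some, Equiv.Perm.permMatrix, PEquiv.toMatrix_apply, Finsupp.single_apply]
      rcases o with _ | j
      · simp
      · by_cases hj : j = σ i
        · simp [hj]
        · have : σ.symm j ≠ i := fun h => hj (by rw [← h]; simp)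
          simp [this, Ne.symm hj]
  rw [h, Matrix.det_mul, Matrix.det_permutation, Equiv.optionCongr_sign, Matrix.det_diagonal]
  simp [Fintype.prod_option]

lemma sgn_sp (bs : Basis (Option (Fin 7)) ℚ V) (σ : Equiv.Perm (Fin 7)) (η : Fin 7 → ℤˣ)
    (h : ∏ i, η i = 1) : sgn (sp bs σ η) = (Equiv.Perm.sign σ : ℤ) := by
  rw [sgn, det_sp, h]
  rcases Int.units_eq_one_or (Equiv.Perm.sign σ) with h | h <;> simp [h]
  norm_num

lemma sp_gen (bs : Basis (Option (Fin 7)) ℚ V) (W : Subgroup (V ≃ₗ[ℚ] V))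
    (hk : ∀ i : Fin 6, sp bs (Equiv.swap i.castSucc i.succ) 1 ∈ W)
    (h7 : sp bs (Equiv.swap 5 6) (fun i => if i = 5 ∨ i = 6 then -1 else 1) ∈ W)
    (σ : Equiv.Perm (Fin 7)) (η : Fin 7 → ℤˣ) (hη : ∏ i, η i = 1) : sp bs σ η ∈ W := by
  have hperm : ∀ τ : Equiv.Perm (Fin 7), sp bs τ 1 ∈ W := by
    intro τ
    have ht : τ ∈ Submonoid.closure (Set.range fun i : Fin 6 ↦ Equiv.swap i.castSucc i.succ) := by
      rw [Equiv.Perm.mclosure_swap_castSucc_succ]; trivial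
    induction ht using Submonoid.closure_induction with
    | mem x hx => obtain ⟨i, rfl⟩ := hx; exact hk i
    | one => rw [sp_one]; exact one_mem _
    | mul x y _ _ hx hy =>
      have := mul_mem hx hy
      rw [sp_mul] at this
      convert this using 2
      ext i; simp
  let D : (Fin 7 → ℤˣ) →* (V ≃ₗ[ℚ] V) :=
    { toFun := fun η => sp bs 1 η
      map_one' := sp_one bs
      map_mul' := fun a b => by
        rw [sp_mul]; congr 1; ext i; simp [mul_comm] }
  have hD' : ∀ η, D η = sp bs 1 η := fun _ => rfl
  have h56 : D (fun i => if i = 5 ∨ i = 6 then -1 else 1) ∈ W := by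
    have := mul_mem (hperm (Equiv.swap 5 6)) h7
    rw [sp_mul] at this
    rw [hD']
    have e1 : Equiv.swap (5 : Fin 7) 6 * Equiv.swap 5 6 = 1 := by simp
    have e2 : (fun i : Fin 7 => (if i = 5 ∨ i = 6 then (-1 : ℤˣ) else 1) *
        (1 : Fin 7 → ℤˣ) ((Equiv.swap (5 : Fin 7) 6) i)) =
        fun i => if i = 5 ∨ i = 6 then -1 else 1 := by
      funext i; simp
    rw [e1, e2] at this
    exact this
  have hdi : ∀ i : Fin 7, i ≠ 6 → D (Pi.mulSingle i (-1) * Pi.mulSingle 6 (-1)) ∈ W := by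
    intro i hi
    have := mul_mem (mul_mem (hperm (Equiv.swap i 5)) h56) (hperm (Equiv.swap i 5))
    rw [hD', sp_mul, sp_mul] at this
    rw [hD']
    have e1 : Equiv.swap i 5 * 1 * Equiv.swap i 5 = 1 := by simp
    have e2 : ∀ i : Fin 7, i ≠ 6 → (fun k : Fin 7 => (1 : Fin 7 → ℤˣ) k *
        ((if (Equiv.swap i 5) k = 5 ∨ (Equiv.swap i 5) k = 6 then (-1 : ℤˣ) else 1) *
        (1 : Fin 7 → ℤˣ) ((1 : Equiv.Perm (Fin 7)) ((Equiv.swap i 5) k)))) =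
        Pi.mulSingle i (-1) * Pi.mulSingle 6 (-1) := by
      decide
    rw [e1, e2 i hi] at this
    exact this
  have hD : D η ∈ W := by
    have e : η = ∏ i, (Pi.mulSingle i (η i) * Pi.mulSingle 6 (η i)) := by
      rw [Finset.prod_mul_distrib, Finset.univ_prod_mulSingle]
      have : ∏ i, (Pi.mulSingle 6 (η i) : Fin 7 → ℤˣ) = 1 := by
        have := map_prod (MonoidHom.mulSingle (fun _ : Fin 7 => ℤˣ) 6) η Finset.univ
        rw [hη, map_one] at this
        exact this.symm
      rw [this, mul_one]
    have : η ∈ W.comap D := by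
      rw [e]
      refine Subgroup.prod_mem _ fun i _ => ?_
      rw [Subgroup.mem_comap]
      rcases Int.units_eq_one_or (η i) with h | h
      · rw [h]; simp
      · rw [h]
        by_cases hi : i = 6
        · subst hi
          rw [← Pi.mulSingle_mul]; simp
        · exact hdi i hi
    exact this
  have := mul_mem (hperm σ) hD
  rw [hD', sp_mul] at this
  have e2 : (fun i : Fin 7 => η i * (1 : Fin 7 → ℤˣ) ((1 : Equiv.Perm (Fin 7)) i)) = η := by
    funext i; simp
  rw [mul_one, e2] at this
  exact this

lemma sp_closed (bs : Basis (Option (Fin 7)) ℚ V) (S : Set (V ≃ₗ[ℚ] V))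
    (hS : ∀ g ∈ S, ∃ σ η, ∏ i, η i = 1 ∧ g = sp bs σ η)
    (w : V ≃ₗ[ℚ] V) (hw : w ∈ Subgroup.closure S) : ∃ σ η, ∏ i, η i = 1 ∧ w = sp bs σ η := by
  induction hw using Subgroup.closure_induction with
  | mem x hx => exact hS x hx
  | one => exact ⟨1, 1, by simp, (sp_one bs).symm⟩
  | mul x y _ _ hx hy =>
    obtain ⟨σ, η, h, rfl⟩ := hx
    obtain ⟨τ, ζ, h', rfl⟩ := hy
    refine ⟨_, _, ?_, sp_mul bs σ τ η ζ⟩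
    rw [Finset.prod_mul_distrib, h', Equiv.prod_comp τ η, h, one_mul]
  | inv x _ hx =>
    obtain ⟨σ, η, h, rfl⟩ := hx
    refine ⟨σ⁻¹, fun i => η (σ⁻¹ i), ?_, ?_⟩
    · rw [Equiv.prod_comp σ⁻¹ η, h]
    · rw [inv_eq_iff_mul_eq_one, sp_mul, ← sp_one bs]
      congr 1
      · simp
      · ext i; simp

end SignedPerm

section ExpSum

open Module

variable {V : Type*} [AddCommGroup V] [Module ℚ V]

lemma expK_add (u v : V) : expK (u + v) = expK u * expK v := by
  simp [expK, ← map_mul, AddMonoidAlgebra.single_mul_single]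

lemma expK_zero : expK (0 : V) = 1 := by
  have : (AddMonoidAlgebra.single (0 : V) (1 : ℤ)) = 1 := rfl
  rw [expK, this, map_one]

lemma expK_ne_zero (v : V) : expK v ≠ 0 := by
  intro h
  have := expK_add v (-v)
  rw [h, add_neg_cancel, expK_zero, zero_mul] at this
  exact one_ne_zero this

lemma expK_neg (v : V) : expK (-v) = (expK v)⁻¹ := by
  apply eq_inv_of_mul_eq_one_left
  rw [← expK_add, neg_add_cancel, expK_zero]

lemma expK_sum {ι : Type*} (s : Finset ι) (f : ι → V) :
    expK (∑ i ∈ s, f i) = ∏ i ∈ s, expK (f i) := by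
  classical
  induction s using Finset.induction_on with
  | empty => simp [expK_zero]
  | insert a s ha ih => rw [Finset.sum_insert ha, Finset.prod_insert ha, expK_add, ih]

lemma expK_nsmul (n : ℕ) (v : V) : expK ((n : ℚ) • v) = expK v ^ n := by
  induction n with
  | zero => simp [expK_zero]
  | succ n ih => rw [Nat.cast_succ, add_smul, one_smul, expK_add, ih, pow_succ]

lemma expK_inj : Function.Injective (expK : V → _) := by
  intro u v h
  have h1 := IsFractionRing.injective (AddMonoidAlgebra ℤ V) (FractionRing (AddMonoidAlgebra ℤ V)) h
  exact (AddMonoidAlgebra.single_left_inj (by norm_num)).1 h1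

lemma one_sub_expK_ne_zero (v : V) (h : v ≠ 0) : 1 - expK v ≠ 0 := by
  intro h'
  rw [sub_eq_zero, ← expK_zero] at h'
  exact h (expK_inj h'.symm)

set_option linter.unusedSectionVars false in
lemma two_ne_zero_K : (2 : FractionRing (AddMonoidAlgebra ℤ V)) ≠ 0 := by
  intro h
  have h3 : (AddMonoidAlgebra.single (0 : V) (2 : ℤ)) = AddMonoidAlgebra.single (0 : V) (0 : ℤ) := by
    apply IsFractionRing.injective (AddMonoidAlgebra ℤ V) (FractionRing (AddMonoidAlgebra ℤ V))
    have : (AddMonoidAlgebra.single (0 : V) (2 : ℤ)) = 2 := rfl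
    rw [this, AddMonoidAlgebra.single_zero, map_zero, map_ofNat, h]
  have := AddMonoidAlgebra.single_right_inj.1 h3
  norm_num at this

/-- Even signed permutations. -/
noncomputable def evenP : Finset (Equiv.Perm (Fin 7) × (Fin 7 → ℤˣ)) :=
  Finset.univ.filter (fun p => ∏ i, p.2 i = 1)

lemma mem_evenP (p : Equiv.Perm (Fin 7) × (Fin 7 → ℤˣ)) : p ∈ evenP ↔ ∏ i, p.2 i = 1 := by
  simp only [evenP, Finset.mem_filter, Finset.mem_univ, true_and]

/-- Reindexing a sum over the group of even signed permutations. -/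
lemma sum_evenP {G K : Type*} [AddCommMonoid K] (S : Finset G)
    (q : Equiv.Perm (Fin 7) → (Fin 7 → ℤˣ) → G)
    (hin : ∀ σ η, ∏ i, η i = 1 → q σ η ∈ S)
    (hout : ∀ w ∈ S, ∃ σ η, ∏ i, η i = 1 ∧ w = q σ η)
    (hinj : ∀ σ η σ' η', q σ η = q σ' η' → σ = σ' ∧ η = η')
    (f : G → K) (g : Equiv.Perm (Fin 7) × (Fin 7 → ℤˣ) → K)
    (hfg : ∀ p : Equiv.Perm (Fin 7) × (Fin 7 → ℤˣ), ∏ i, p.2 i = 1 → f (q p.1 p.2) = g p) :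
    ∑ w ∈ S, f w = ∑ p ∈ evenP, g p := by
  have hm := mem_evenP
  generalize evenP = E at hm ⊢
  symm
  refine Finset.sum_bij (fun p _ => q p.1 p.2) ?_ ?_ ?_ ?_
  · intro p hp
    exact hin _ _ ((hm p).1 hp)
  · intro p _ p' _ h
    obtain ⟨h1, h2⟩ := hinj _ _ _ _ h
    exact Prod.ext h1 h2
  · intro w hw
    obtain ⟨σ, η, hη, rfl⟩ := hout w hw
    exact ⟨(σ, η), (hm (σ, η)).2 hη, rfl⟩
  · intro p hp
    exact (hfg p ((hm p).1 hp)).symm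

set_option maxRecDepth 10000 in
lemma sum_sp_det (bs : Basis (Option (Fin 7)) ℚ V) :
    2 * (∑ p ∈ evenP,
      (Equiv.Perm.sign p.1 : ℤ) • expK (sp bs p.1 p.2
          ((23 : ℚ) • bs none + ∑ i : Fin 7, ((6 - (i : ℕ) : ℕ) : ℚ) • bs (some i))) /
        (1 - expK (-(sp bs p.1 p.2 (bs none - bs (some 0))))))
    = expK ((23 : ℚ) • bs none) * (Matrix.of fun j i : Fin 7 =>
      if i = 0 then expK (bs (some j)) ^ 6 / (1 - expK (-bs none) * expK (bs (some j)))
        + (expK (bs (some j)))⁻¹ ^ 6 / (1 - expK (-bs none) * (expK (bs (some j)))⁻¹)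
        else TT (expK (bs (some j))) (6 - (i : ℕ))).det := by
  classical
  set y := expK (-bs none) with hy
  let X : Fin 7 → ℤˣ → FractionRing (AddMonoidAlgebra ℤ V) :=
    fun j ε => expK ((((ε : ℤ)) : ℚ) • bs (some j))
  let f : Fin 7 → Fin 7 → ℤˣ → FractionRing (AddMonoidAlgebra ℤ V) :=
    fun i j ε => if i = 0 then X j ε ^ 6 / (1 - y * X j ε) else X j ε ^ (6 - (i : ℕ))
  let F : Equiv.Perm (Fin 7) × (Fin 7 → ℤˣ) → FractionRing (AddMonoidAlgebra ℤ V) :=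
    fun p => (((Equiv.Perm.sign p.1 : ℤ)) : FractionRing (AddMonoidAlgebra ℤ V)) *
      ∏ i, f i (p.1 i) (p.2 i)
  have hterm : ∀ p : Equiv.Perm (Fin 7) × (Fin 7 → ℤˣ),
      (Equiv.Perm.sign p.1 : ℤ) • expK (sp bs p.1 p.2
          ((23 : ℚ) • bs none + ∑ i : Fin 7, ((6 - (i : ℕ) : ℕ) : ℚ) • bs (some i))) /
        (1 - expK (-(sp bs p.1 p.2 (bs none - bs (some 0)))))
      = expK ((23 : ℚ) • bs none) * F p := by
    intro p
    have e1 : expK (sp bs p.1 p.2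
          ((23 : ℚ) • bs none + ∑ i : Fin 7, ((6 - (i : ℕ) : ℕ) : ℚ) • bs (some i))) =
        expK ((23 : ℚ) • bs none) * ∏ i, X (p.1 i) (p.2 i) ^ (6 - (i : ℕ)) := by
      rw [map_add, map_smul, sp_none, map_sum, expK_add, expK_sum]
      congr 1
      refine Finset.prod_congr rfl fun i _ => ?_
      rw [map_smul, expK_nsmul, sp_some]
    have e2 : expK (-(sp bs p.1 p.2 (bs none - bs (some 0)))) = y * X (p.1 0) (p.2 0) := by
      rw [map_sub, sp_none, sp_some, neg_sub, sub_eq_add_neg, add_comm, expK_add]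
    have e3 : ∏ i, f i (p.1 i) (p.2 i) =
        (∏ i, X (p.1 i) (p.2 i) ^ (6 - (i : ℕ))) / (1 - y * X (p.1 0) (p.2 0)) := by
      rw [Fin.prod_univ_succ, Fin.prod_univ_succ (n := 6)]
      simp [f, Fin.succ_ne_zero]
      ring
    rw [e1, e2, zsmul_eq_mul]
    simp only [F]
    rw [e3]
    ring
  rw [Finset.sum_congr rfl fun p _ => hterm p, ← Finset.mul_sum]
  rw [evenP]
  have hflip : 2 * ∑ p ∈ (Finset.univ : Finset (Equiv.Perm (Fin 7) × (Fin 7 → ℤˣ))).filter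
        (fun p => ∏ i, p.2 i = 1), F p = ∑ p, F p := by
    rw [two_mul, ← Finset.sum_filter_add_sum_filter_not Finset.univ
      (fun p : Equiv.Perm (Fin 7) × (Fin 7 → ℤˣ) => ∏ i, p.2 i = 1) F]
    rw [add_right_inj]
    refine Finset.sum_nbij' (fun p => (p.1, p.2 * Pi.mulSingle 6 (-1)))
      (fun p => (p.1, p.2 * Pi.mulSingle 6 (-1))) ?_ ?_ ?_ ?_ ?_
    · intro p hp
      simp only [Finset.mem_filter, Finset.mem_univ, true_and] at hp ⊢
      simp only [Pi.mul_apply, Finset.prod_mul_distrib, hp]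
      simp
    · intro p hp
      simp only [Finset.mem_filter, Finset.mem_univ, true_and] at hp ⊢
      have := (Int.units_eq_one_or _).resolve_left hp
      simp only [Pi.mul_apply, Finset.prod_mul_distrib, this]
      simp
    · intro p _
      simp [mul_assoc, ← Pi.mulSingle_mul]
    · intro p _
      simp [mul_assoc, ← Pi.mulSingle_mul]
    · intro p _
      have hpr : ∏ i, f i (p.1 i) (p.2 i) =
          ∏ i, f i (p.1 i) ((p.2 * Pi.mulSingle 6 (-1) : Fin 7 → ℤˣ) i) := by
        refine Finset.prod_congr rfl fun i _ => ?_
        by_cases hi : i = 6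
        · subst hi
          have h6 : (6 : Fin 7) ≠ 0 := by decide
          simp [f, h6]
        · simp [hi]
      simp only [F, hpr]
  rw [mul_left_comm, hflip]
  refine congrArg (fun z => _ * z) ?_
  rw [Fintype.sum_prod_type, Matrix.det_apply']
  refine Finset.sum_congr rfl fun σ _ => ?_
  simp only [F]
  rw [← Finset.mul_sum]
  congr 1
  have := (Fintype.prod_sum (fun i ε => f i (σ i) ε)).symm
  rw [this]
  refine Finset.prod_congr rfl fun i _ => ?_
  have hu : (Finset.univ : Finset ℤˣ) = {1, -1} := rfl
  rw [hu, Finset.sum_pair (by decide)]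
  by_cases hi : i = 0
  · simp [f, hi, X, expK_neg]
  · simp [f, hi, X, expK_neg, TT]

end ExpSum

section Roots

open Module

/-- orthogonal coordinates of the simple roots of the D7 part -/
def Rz : Matrix (Fin 7) (Fin 7) ℤ :=
  !![0, 0, 0, 0, 0, 1, -1;
     0, 0, 0, 0, 1, -1, 0;
     0, 0, 0, 1, -1, 0, 0;
     0, 0, 1, -1, 0, 0, 0;
     0, 1, -1, 0, 0, 0, 0;
     1, -1, 0, 0, 0, 0, 0;
     0, 0, 0, 0, 0, 1, 1]

/-- twice the orthogonal coordinates of the spinor simple root -/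
def r0 : Fin 7 → ℤ := ![-1, -1, -1, -1, -1, -1, 1]

lemma sq_sum_one (s : Finset (Fin 7)) (m : Fin 7 → ℤ) (h : ∑ i ∈ s, m i ^ 2 = 1) :
    ∃ i ∈ s, ∃ ε : ℤˣ, m i = ε ∧ ∀ j ∈ s, j ≠ i → m j = 0 := by
  have hex : ∃ i ∈ s, m i ≠ 0 := by
    by_contra! hc
    rw [Finset.sum_eq_zero (fun i hi => by rw [hc i hi]; rfl)] at h
    norm_num at h
  obtain ⟨i, hi, hne⟩ := hex
  rw [← Finset.add_sum_erase s _ hi] at h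
  have hpos : 0 < m i ^ 2 := by positivity
  have hnn : 0 ≤ ∑ j ∈ s.erase i, m j ^ 2 := Finset.sum_nonneg fun _ _ => sq_nonneg _
  have h1 : m i ^ 2 = 1 := by omega
  have h2 : ∑ j ∈ s.erase i, m j ^ 2 = 0 := by omega
  rw [Finset.sum_eq_zero_iff_of_nonneg fun _ _ => sq_nonneg _] at h2
  have h3 : ∀ j ∈ s, j ≠ i → m j = 0 := fun j hj hji =>
    pow_eq_zero_iff (two_ne_zero) |>.1 (h2 j (Finset.mem_erase.2 ⟨hji, hj⟩))
  rcases (mul_self_eq_one_iff (a := m i)).1 (by rw [← sq]; exact h1) with h | h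
  · exact ⟨i, hi, 1, by simp [h], h3⟩
  · exact ⟨i, hi, -1, by simp [h], h3⟩

lemma sq_sum_two (m : Fin 7 → ℤ) (h : ∑ i, m i ^ 2 = 2) :
    ∃ i j, i < j ∧ ∃ ε ε' : ℤˣ, m i = ε ∧ m j = ε' ∧ ∀ k, k ≠ i → k ≠ j → m k = 0 := by
  have hex : ∃ i, m i ≠ 0 := by
    by_contra! hc
    simp [hc] at h
  obtain ⟨i, hne⟩ := hex
  rw [← Finset.add_sum_erase _ _ (Finset.mem_univ i)] at h
  have hpos : 0 < m i ^ 2 := by positivity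
  have hnn : 0 ≤ ∑ j ∈ Finset.univ.erase i, m j ^ 2 := Finset.sum_nonneg fun _ _ => sq_nonneg _
  have hb : m i ≤ 1 := by nlinarith
  have hb' : -1 ≤ m i := by nlinarith
  have h1 : m i = 1 ∨ m i = -1 := by omega
  have h1' : ∃ ε : ℤˣ, m i = ε := by
    rcases h1 with h | h
    · exact ⟨1, by simp [h]⟩
    · exact ⟨-1, by simp [h]⟩
  have h2 : ∑ j ∈ Finset.univ.erase i, m j ^ 2 = 1 := by
    rcases h1 with h' | h' <;> rw [h'] at h <;> omega
  obtain ⟨j, hj, ε', hε', h3⟩ := sq_sum_one _ _ h2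
  obtain ⟨ε, hε⟩ := h1'
  have hji := (Finset.mem_erase.1 hj).1
  rcases lt_or_gt_of_ne hji with hl | hl
  · exact ⟨j, i, hl, ε', ε, hε', hε, fun k hk hk' => h3 k (by simp [hk']) hk⟩
  · exact ⟨i, j, hl, ε, ε', hε, hε', fun k hk hk' => h3 k (by simp [hk]) hk'⟩

variable {V : Type*} [AddCommGroup V] [Module ℚ V]

lemma exists_bs (sroot : Fin 8 → V) (hindep : LinearIndependent ℚ sroot)
    (hspan : Submodule.span ℚ (Set.range sroot) = ⊤) :
    ∃ bs : Basis (Option (Fin 7)) ℚ V,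
      (sroot 0 = (1 / 2 : ℚ) • bs none + ∑ i, ((r0 i : ℚ) / 2) • bs (some i)) ∧
      ∀ b : Fin 7, sroot b.succ = ∑ i, (Rz b i : ℚ) • bs (some i) := by
  let b0 := Basis.mk hindep hspan.ge
  let e6 : V := (1 / 2 : ℚ) • (sroot 7 - sroot 1)
  let e5 : V := (1 / 2 : ℚ) • (sroot 7 + sroot 1)
  let e4 := sroot 2 + e5
  let e3 := sroot 3 + e4
  let e2 := sroot 4 + e3
  let e1 := sroot 5 + e2
  let e0 := sroot 6 + e1
  let δ := (2 : ℚ) • sroot 0 + e0 + e1 + e2 + e3 + e4 + e5 - e6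
  let f : Option (Fin 7) → V := fun o => o.elim δ ![e0, e1, e2, e3, e4, e5, e6]
  have hf0 : sroot 0 = (1 / 2 : ℚ) • f none + ∑ i, ((r0 i : ℚ) / 2) • f (some i) := by
    simp [Fin.sum_univ_succ, f, r0, δ]
    module
  have hfs : ∀ b : Fin 7, sroot b.succ = ∑ i, (Rz b i : ℚ) • f (some i) := by
    intro b
    fin_cases b <;>
    simp [Fin.sum_univ_succ, f, Rz, e0, e1, e2, e3, e4, e5, e6] <;> module
  have hsp : ⊤ ≤ Submodule.span ℚ (Set.range f) := by
    rw [← hspan, Submodule.span_le]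
    rintro _ ⟨a, rfl⟩
    have hm : ∀ o, f o ∈ Submodule.span ℚ (Set.range f) := fun o => Submodule.subset_span ⟨o, rfl⟩
    refine Fin.cases ?_ (fun b => ?_) a
    · rw [hf0]
      exact add_mem (Submodule.smul_mem _ _ (hm _))
        (sum_mem fun i _ => Submodule.smul_mem _ _ (hm _))
    · rw [hfs]
      exact sum_mem fun i _ => Submodule.smul_mem _ _ (hm _)
  have hcard : Fintype.card (Option (Fin 7)) = Module.finrank ℚ V := by
    rw [Module.finrank_eq_card_basis b0]; simp
  refine ⟨basisOfTopLeSpanOfCardEqFinrank f hsp hcard, ?_, ?_⟩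
  · simpa using hf0
  · simpa using hfs

/-- the standard bilinear form for which `bs` is orthonormal -/
noncomputable def cB (bs : Basis (Option (Fin 7)) ℚ V) (u v : V) : ℚ :=
  bs.repr u none * bs.repr v none + ∑ i, bs.repr u (some i) * bs.repr v (some i)

lemma repr_zero (bs : Basis (Option (Fin 7)) ℚ V) (v : V) (c : ℚ) (d : Fin 7 → ℚ)
    (h : v = c • bs none + ∑ i, d i • bs (some i)) :
    bs.repr v none = c ∧ ∀ i, bs.repr v (some i) = d i := by
  subst h
  constructor
  · simp [Finsupp.single_apply]
  · intro i
    simp [Finsupp.single_apply]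

lemma cB_eq (bs : Basis (Option (Fin 7)) ℚ V) (u : V) (v : V) (c : ℚ) (d : Fin 7 → ℚ)
    (h : u = c • bs none + ∑ i, d i • bs (some i)) :
    cB bs u v = c * bs.repr v none + ∑ i, d i * bs.repr v (some i) := by
  obtain ⟨h1, h2⟩ := repr_zero bs u c d h
  simp [cB, h1, h2]

/-- the bilinear form in the second variable -/
noncomputable def cBl (bs : Basis (Option (Fin 7)) ℚ V) (u : V) : V →ₗ[ℚ] ℚ :=
  bs.repr u none • bs.coord none + ∑ i, bs.repr u (some i) • bs.coord (some i)

lemma cBl_apply (bs : Basis (Option (Fin 7)) ℚ V) (u v : V) : cBl bs u v = cB bs u v := by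
  simp [cBl, cB]

lemma gram (bs : Basis (Option (Fin 7)) ℚ V) (sroot : Fin 8 → V)
    (h0 : sroot 0 = (1 / 2 : ℚ) • bs none + ∑ i, ((r0 i : ℚ) / 2) • bs (some i))
    (hS : ∀ b : Fin 7, sroot b.succ = ∑ i, (Rz b i : ℚ) • bs (some i)) (a b : Fin 8) :
    cB bs (sroot a) (sroot b) = cartanE8 a b := by
  have hS' : ∀ b : Fin 7, sroot b.succ = (0 : ℚ) • bs none + ∑ i, (Rz b i : ℚ) • bs (some i) := by
    intro b; rw [hS]; simp
  obtain ⟨p, p'⟩ := repr_zero _ _ _ _ h0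
  have hr := fun b => repr_zero _ _ _ _ (hS' b)
  have q := fun b => (hr b).1
  have q' := fun b => (hr b).2
  refine Fin.cases ?_ (fun a => ?_) a <;> refine Fin.cases ?_ (fun b => ?_) b
  · simp only [cB, p, p']
    simp [Fin.sum_univ_succ, r0, cartanE8]; norm_num
  · simp only [cB, p, p', q, q']
    fin_cases b <;> simp [Fin.sum_univ_succ, r0, Rz, cartanE8] <;> norm_num
  · simp only [cB, p, p', q, q']
    fin_cases a <;> simp [Fin.sum_univ_succ, r0, Rz, cartanE8] <;> norm_num
  · simp only [cB, q, q']
    have : ∀ a b : Fin 7, ∑ i, Rz a i * Rz b i = cartanE8 a.succ b.succ := by decide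
    rw [← this]
    push_cast
    simp

lemma cB_reflect (bs : Basis (Option (Fin 7)) ℚ V) (r v : V) (h : cB bs r r = 2) :
    cB bs (v - cB bs r v • r) (v - cB bs r v • r) = cB bs v v := by
  have e : ∀ c : ℚ, cB bs (v - c • r) (v - c • r) = cB bs v v - 2 * c * cB bs r v
      + c ^ 2 * cB bs r r := by
    intro c
    simp only [cB, map_sub, map_smul, Finsupp.coe_sub, Finsupp.coe_smul, Pi.sub_apply,
      Pi.smul_apply, smul_eq_mul, mul_add, Finset.mul_sum]
    have : ∀ i : Fin 7, (bs.repr v (some i) - c * bs.repr r (some i)) *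
        (bs.repr v (some i) - c * bs.repr r (some i)) =
        bs.repr v (some i) * bs.repr v (some i)
        - 2 * c * (bs.repr r (some i) * bs.repr v (some i))
        + c ^ 2 * (bs.repr r (some i) * bs.repr r (some i)) := fun i => by ring
    simp only [this, Finset.sum_add_distrib, Finset.sum_sub_distrib]
    ring
  rw [e, h]; ring

lemma s_swap (bs : Basis (Option (Fin 7)) ℚ V) (s : V ≃ₗ[ℚ] V) (r : V) (k l : Fin 7)
    (hkl : k ≠ l) (hr : r = bs (some k) - bs (some l)) (hs : ∀ v, s v = v - cB bs r v • r) :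
    s = sp bs (Equiv.swap k l) 1 := by
  have hb : ∀ o, cB bs r (bs o) = (if o = some k then 1 else 0) - (if o = some l then 1 else 0) := by
    intro o
    subst hr
    rcases o with _ | i
    · simp [cB, Finsupp.single_apply]
    · simp [cB, Finsupp.single_apply, eq_comm]
  apply sp_ext
  · simp [hs, hb]
  · intro i
    rw [hs, hb, hr]
    by_cases h1 : i = k
    · subst h1; simp [hkl]
    · by_cases h2 : i = l
      · subst h2; simp [h1]
      · simp [h1, h2, Equiv.swap_apply_of_ne_of_ne]

lemma s_swap' (bs : Basis (Option (Fin 7)) ℚ V) (s : V ≃ₗ[ℚ] V) (r : V) (k l : Fin 7)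
    (hkl : k ≠ l) (hr : r = bs (some k) + bs (some l)) (hs : ∀ v, s v = v - cB bs r v • r) :
    s = sp bs (Equiv.swap k l) (fun i => if i = k ∨ i = l then -1 else 1) := by
  have hb : ∀ o, cB bs r (bs o) = (if o = some k then 1 else 0) + (if o = some l then 1 else 0) := by
    intro o
    subst hr
    rcases o with _ | i
    · simp [cB, Finsupp.single_apply]
    · simp [cB, Finsupp.single_apply, eq_comm]
  apply sp_ext
  · simp [hs, hb]
  · intro i
    rw [hs, hb, hr]
    by_cases h1 : i = k
    · subst h1; simp [hkl]
    · by_cases h2 : i = l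
      · subst h2; simp [h1]
      · simp [h1, h2, Equiv.swap_apply_of_ne_of_ne]

lemma cB_nondeg (bs : Basis (Option (Fin 7)) ℚ V) (sroot : Fin 8 → V)
    (h0 : sroot 0 = (1 / 2 : ℚ) • bs none + ∑ i, ((r0 i : ℚ) / 2) • bs (some i))
    (hS : ∀ b : Fin 7, sroot b.succ = ∑ i, (Rz b i : ℚ) • bs (some i)) (u v : V)
    (h : ∀ a, cB bs (sroot a) u = cB bs (sroot a) v) : u = v := by
  have hS' : ∀ b : Fin 7, sroot b.succ = (0 : ℚ) • bs none + ∑ i, (Rz b i : ℚ) • bs (some i) := by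
    intro b; rw [hS]; simp
  have z0 := h 0
  rw [cB_eq _ _ _ _ _ h0, cB_eq _ _ _ _ _ h0] at z0
  have zs := fun b : Fin 7 => h b.succ
  simp only [cB_eq _ _ _ _ _ (hS' _)] at zs
  have y0 := zs 0
  have y1 := zs 1
  have y2 := zs 2
  have y3 := zs 3
  have y4 := zs 4
  have y5 := zs 5
  have y6 := zs 6
  simp [Fin.sum_univ_succ, Rz, r0] at z0 y0 y1 y2 y3 y4 y5 y6
  apply bs.ext_elem
  rintro (_ | i)
  · linarith
  · fin_cases i <;> simp <;> linarith

end Roots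

section Prods

open Module

variable {V : Type*} [AddCommGroup V] [Module ℚ V]

lemma prod_level2 (bs : Basis (Option (Fin 7)) ℚ V) (P : Finset V)
    (hP : ∀ v, v ∈ P ↔ ∃ (i : Fin 7) (ε : ℤˣ), v = bs none + ((ε : ℤ) : ℚ) • bs (some i)) :
    ∏ α ∈ P, (1 - expK (-α)) = ∏ j, ((1 - expK (-bs none) * expK (bs (some j))) *
      (1 - expK (-bs none) * (expK (bs (some j)))⁻¹)) := by
  classical
  have hPe : P = (Finset.univ : Finset (Fin 7 × ℤˣ)).image
      (fun p => bs none + ((p.2 : ℤ) : ℚ) • bs (some p.1)) := by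
    ext v
    rw [hP]
    simp [eq_comm]
  rw [hPe, Finset.prod_image, Fintype.prod_prod_type]
  · refine Finset.prod_congr rfl fun j _ => ?_
    have hu : (Finset.univ : Finset ℤˣ) = {1, -1} := rfl
    rw [hu, Finset.prod_pair (by decide)]
    simp [expK_add, expK_neg]
    ring
  · rintro ⟨i, ε⟩ _ ⟨j, ε'⟩ _ h
    have h2 := congrArg (fun v => bs.repr v (some i)) (add_left_cancel h)
    simp [Finsupp.single_apply] at h2
    by_cases hij : j = i
    · simp [hij] at h2 ⊢
      exact Units.ext h2
    · simp [hij] at h2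

lemma prod_level0 (bs : Basis (Option (Fin 7)) ℚ V) (P : Finset V)
    (hP : ∀ v, v ∈ P ↔ ∃ (i j : Fin 7) (ε : ℤˣ), i < j ∧
      v = bs (some i) + ((ε : ℤ) : ℚ) • bs (some j)) :
    (∏ i : Fin 7, expK (bs (some i)) ^ (6 - (i : ℕ))) * ∏ α ∈ P, (1 - expK (-α)) =
      ∏ i : Fin 7, ∏ j ∈ Finset.Ioi i, ((expK (bs (some i)) - expK (bs (some j))) *
        (1 - (expK (bs (some i)))⁻¹ * (expK (bs (some j)))⁻¹)) := by
  classical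
  have hPe : P = ((Finset.univ.sigma (fun i : Fin 7 => Finset.Ioi i)) ×ˢ
      (Finset.univ : Finset ℤˣ)).image
      (fun p => bs (some p.1.1) + ((p.2 : ℤ) : ℚ) • bs (some p.1.2)) := by
    ext v
    rw [hP]
    simp only [Finset.mem_image, Finset.mem_product, Finset.mem_sigma, Finset.mem_univ, true_and,
      and_true, Finset.mem_Ioi]
    constructor
    · rintro ⟨i, j, ε, h, rfl⟩
      exact ⟨(⟨i, j⟩, ε), h, rfl⟩
    · rintro ⟨⟨⟨i, j⟩, ε⟩, h, rfl⟩
      exact ⟨i, j, ε, h, rfl⟩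
  rw [hPe, Finset.prod_image, Finset.prod_product, Finset.prod_sigma, ← Finset.prod_mul_distrib]
  · refine Finset.prod_congr rfl fun i _ => ?_
    have hc : (Finset.Ioi i).card = 6 - (i : ℕ) := by simp
    rw [← hc, ← Finset.prod_const, ← Finset.prod_mul_distrib]
    refine Finset.prod_congr rfl fun j _ => ?_
    have hu : (Finset.univ : Finset ℤˣ) = {1, -1} := rfl
    rw [hu, Finset.prod_pair (by decide)]
    have h1 := expK_ne_zero (bs (some i))
    have h2 := expK_ne_zero (bs (some j))
    simp [expK_add, expK_neg]
    field_simp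
  · rintro ⟨⟨i, j⟩, ε⟩ hp ⟨⟨i', j'⟩, ε'⟩ hp' h
    simp only [Finset.coe_product, Finset.coe_sigma, Set.mem_prod, Set.mem_sigma_iff, Finset.coe_univ,
      Set.mem_univ, true_and, and_true, Finset.coe_Ioi, Set.mem_Ioi] at hp hp'
    have h2 : ∀ k, ((if i = k then 1 else 0) + (if j = k then ((ε : ℤ) : ℚ) else 0)) =
        ((if i' = k then 1 else 0) + (if j' = k then ((ε' : ℤ) : ℚ) else 0)) := fun k => by
      have := congrArg (fun v => bs.repr v (some k)) h
      simpa [Finsupp.single_apply] using this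
    have a1 := h2 i
    have a2 := h2 j
    have a3 := h2 i'
    have a4 := h2 j'
    have hn := hp.ne
    have hn' := hp'.ne
    have key : i = i' ∧ j = j' ∧ ε = ε' := by
      rcases Int.units_eq_one_or ε with h | h <;> rcases Int.units_eq_one_or ε' with h' | h' <;>
      subst h <;> subst h' <;> simp [hn, hn', hn.symm, hn'.symm] at a1 a2 a3 a4 ⊢ <;>
      grind
    obtain ⟨rfl, rfl, rfl⟩ := key
    rfl

end Prods

/-!
STATEMENT 9.  Let `Φ` be the root system of type E8 (labelled as above).  With
`S_1 = ∑_{w ∈ W_{ω_1}} det(w) e^{w(ρ)} / (1 - e^{-w(ω_1 - ω_7)})` in the fraction field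
`K` of `ℤ[Q]`, where `W_{ω_1}` is the parabolic subgroup generated by
`{s_b : b ∈ {2,…,8}}` (the stabilizer of `ω_1`, of type D7), one has
`S_1 ⬝ ∏_{α ∈ Φ⁺, [α]_1 = 2} (1 - e^{-α})
   = (1 - e^{-ω_1}) ⬝ e^{ρ} ⬝ ∏_{α ∈ Φ⁺, [α]_1 = 0} (1 - e^{-α})`.
(Node `1` is index `0` and node `7` is index `6`.)
-/
theorem E8_node1_polyhedral_denominator_identity
    {V : Type*} [AddCommGroup V] [Module ℚ V] [FiniteDimensional ℚ V]
    (Φ Φpos : Finset V) (sroot : Fin 8 → V) (cpair : Fin 8 → V →ₗ[ℚ] ℚ)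
    (coeff : V → Fin 8 → ℤ) (C : Fin 8 → Fin 8 → ℤ) (s : Fin 8 → V ≃ₗ[ℚ] V)
    -- axioms of a reduced crystallographic root system with base:
    (hindep : LinearIndependent ℚ sroot)
    (hspan : Submodule.span ℚ (Set.range sroot) = ⊤)
    (hC : ∀ a b, (C a b : ℚ) = cpair a (sroot b))
    (hs : ∀ a v, s a v = v - cpair a v • sroot a)
    (hsimple : ∀ a, sroot a ∈ Φpos)
    (hpossub : Φpos ⊆ Φ)
    (hzero : (0 : V) ∉ Φ)
    (hsymm : ∀ β ∈ Φ, -β ∈ Φ)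
    (hsign : ∀ β ∈ Φ, β ∈ Φpos ∨ -β ∈ Φpos)
    (hcoeff : ∀ β ∈ Φ, β = ∑ b, coeff β b • sroot b)
    (hnonneg : ∀ β ∈ Φpos, ∀ b, 0 ≤ coeff β b)
    (hred : ∀ β ∈ Φ, ∀ t : ℚ, t • β ∈ Φ → t = 1 ∨ t = -1)
    (hsΦ : ∀ a, ∀ β ∈ Φ, s a β ∈ Φ)
    (hΦorbit : ∀ β ∈ Φ, ∃ w ∈ Subgroup.closure {g : V ≃ₗ[ℚ] V | ∃ b, g = s b},
        ∃ b, β = w (sroot b))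
    -- `Φ` is of type E8 with the labelling above:
    (hCmat : ∀ a b, C a b = cartanE8 a b)
    -- the fundamental weights and the Weyl vector (which lie in `Q` for E8):
    (ω : Fin 8 → V) (hω : ∀ a b, cpair b (ω a) = if a = b then 1 else 0)
    (ρ : V) (hρ : ρ = ∑ a, ω a)
    -- the parabolic subgroup `W_{ω_1}` generated by `s_2, …, s_8`:
    (W1 : Subgroup (V ≃ₗ[ℚ] V))
    (hW1 : W1 = Subgroup.closure {g : V ≃ₗ[ℚ] V | ∃ b : Fin 8, b ≠ 0 ∧ g = s b})
    (hfin : (W1 : Set (V ≃ₗ[ℚ] V)).Finite) :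
    (∑ w ∈ hfin.toFinset,
        sgn w • expK (w ρ) / (1 - expK (-(w (ω 0 - ω 6)))))
      * ∏ α ∈ Φpos.filter (fun α => coeff α 0 = 2), (1 - expK (-α))
    = (1 - expK (-(ω 0))) * expK ρ
      * ∏ α ∈ Φpos.filter (fun α => coeff α 0 = 0), (1 - expK (-α)) := by
  classical
  obtain ⟨bs, h0, hS⟩ := exists_bs sroot hindep hspan
  have hS' : ∀ b : Fin 7, sroot b.succ = (0 : ℚ) • bs none + ∑ i, (Rz b i : ℚ) • bs (some i) := by
    intro b; rw [hS]; simp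
  have hgram := gram bs sroot h0 hS
  -- the coroot pairings are given by the standard form
  have hcp : ∀ a v, cpair a v = cB bs (sroot a) v := by
    intro a v
    rw [← cBl_apply]
    have : cpair a = cBl bs (sroot a) := by
      apply LinearMap.ext_on_range hspan
      intro b
      rw [cBl_apply, hgram, ← hCmat, hC]
    rw [this]
  have hrr : ∀ a, cB bs (sroot a) (sroot a) = 2 := by
    intro a
    rw [hgram]
    fin_cases a <;> simp [cartanE8]
  have hs' : ∀ a v, s a v = v - cB bs (sroot a) v • sroot a := by
    intro a v; rw [hs, hcp]
  -- the generators as signed permutations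
  have g6 : s 6 = sp bs (Equiv.swap 0 1) 1 :=
    s_swap bs _ _ 0 1 (by decide) (by
      have := hS 5; simp [Fin.sum_univ_succ, Rz] at this; simpa [sub_eq_add_neg] using this) (hs' 6)
  have g5 : s 5 = sp bs (Equiv.swap 1 2) 1 :=
    s_swap bs _ _ 1 2 (by decide) (by
      have := hS 4; simp [Fin.sum_univ_succ, Rz] at this; simpa [sub_eq_add_neg] using this) (hs' 5)
  have g4 : s 4 = sp bs (Equiv.swap 2 3) 1 :=
    s_swap bs _ _ 2 3 (by decide) (by
      have := hS 3; simp [Fin.sum_univ_succ, Rz] at this; simpa [sub_eq_add_neg] using this) (hs' 4)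
  have g3 : s 3 = sp bs (Equiv.swap 3 4) 1 :=
    s_swap bs _ _ 3 4 (by decide) (by
      have := hS 2; simp [Fin.sum_univ_succ, Rz] at this; simpa [sub_eq_add_neg] using this) (hs' 3)
  have g2 : s 2 = sp bs (Equiv.swap 4 5) 1 :=
    s_swap bs _ _ 4 5 (by decide) (by
      have := hS 1; simp [Fin.sum_univ_succ, Rz] at this; simpa [sub_eq_add_neg] using this) (hs' 2)
  have g1 : s 1 = sp bs (Equiv.swap 5 6) 1 :=
    s_swap bs _ _ 5 6 (by decide) (by
      have := hS 0; simp [Fin.sum_univ_succ, Rz] at this; simpa [sub_eq_add_neg] using this) (hs' 1)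
  have g7 : s 7 = sp bs (Equiv.swap 5 6) (fun i => if i = 5 ∨ i = 6 then -1 else 1) :=
    s_swap' bs _ _ 5 6 (by decide) (by
      have := hS 6; simp [Fin.sum_univ_succ, Rz] at this; simpa using this) (hs' 7)
  have hgenmem : ∀ b : Fin 8, b ≠ 0 → s b ∈ W1 := by
    intro b hb
    rw [hW1]
    exact Subgroup.subset_closure ⟨b, hb, rfl⟩
  have hWin : ∀ σ η, ∏ i, η i = 1 → sp bs σ η ∈ W1 := by
    apply sp_gen
    · intro i
      fin_cases i
      · exact g6 ▸ hgenmem 6 (by decide)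
      · exact g5 ▸ hgenmem 5 (by decide)
      · exact g4 ▸ hgenmem 4 (by decide)
      · exact g3 ▸ hgenmem 3 (by decide)
      · exact g2 ▸ hgenmem 2 (by decide)
      · exact g1 ▸ hgenmem 1 (by decide)
    · exact g7 ▸ hgenmem 7 (by decide)
  have hWout : ∀ w ∈ W1, ∃ σ η, ∏ i, η i = 1 ∧ w = sp bs σ η := by
    intro w hw
    rw [hW1] at hw
    refine sp_closed bs _ ?_ w hw
    rintro _ ⟨b, hb, rfl⟩
    fin_cases b
    · exact absurd rfl hb
    · exact ⟨_, _, by decide, g1⟩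
    · exact ⟨_, _, by decide, g2⟩
    · exact ⟨_, _, by decide, g3⟩
    · exact ⟨_, _, by decide, g4⟩
    · exact ⟨_, _, by decide, g5⟩
    · exact ⟨_, _, by decide, g6⟩
    · exact ⟨_, _, by decide, g7⟩
  -- weights
  have hnd := cB_nondeg bs sroot h0 hS
  have hω0 : ω 0 = (2 : ℚ) • bs none := by
    apply hnd
    intro a
    rw [← hcp, hω]
    refine Fin.cases ?_ (fun b => ?_) a
    · rw [cB_eq _ _ _ _ _ h0]; simp
    · rw [cB_eq _ _ _ _ _ (hS' b)]; simp [(Fin.succ_ne_zero b).symm]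
  have hω6 : ω 6 = bs none + bs (some 0) := by
    apply hnd
    intro a
    rw [← hcp, hω]
    refine Fin.cases ?_ (fun b => ?_) a
    · rw [cB_eq _ _ _ _ _ h0]; simp [Finsupp.single_apply, r0]; norm_num
    · rw [cB_eq _ _ _ _ _ (hS' b)]
      have : ∀ b : Fin 7, Rz b 0 = if (6 : Fin 8) = b.succ then 1 else 0 := by decide
      simp [Finsupp.single_apply, this]
  have hρ' : ρ = (23 : ℚ) • bs none + ∑ i : Fin 7, ((6 - (i : ℕ) : ℕ) : ℚ) • bs (some i) := by
    apply hnd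
    intro a
    obtain ⟨r1, r2⟩ := repr_zero bs _ (23 : ℚ) (fun i : Fin 7 => ((6 - (i : ℕ) : ℕ) : ℚ)) rfl
    have : cB bs (sroot a) ρ = 1 := by
      rw [← hcp, hρ, map_sum]
      simp [hω]
    rw [this]
    refine Fin.cases ?_ (fun b => ?_) a
    · rw [cB_eq _ _ _ _ _ h0]
      simp only [r1, r2]
      simp [Fin.sum_univ_succ, r0]; norm_num
    · rw [cB_eq _ _ _ _ _ (hS' b)]
      simp only [r1, r2]
      have h : ∀ b : Fin 7, ∑ i : Fin 7, Rz b i * ((6 - (i : ℕ) : ℕ) : ℤ) = 1 := by decide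
      have h' := congrArg (fun z : ℤ => (z : ℚ)) (h b)
      push_cast at h'
      rw [zero_mul, zero_add]
      push_cast
      exact h'.symm
  -- properties of roots
  have hq : ∀ β ∈ Φ, cB bs β β = 2 := by
    intro β hβ
    obtain ⟨w, hw, b, rfl⟩ := hΦorbit β hβ
    have hinv : ∀ v, cB bs (w v) (w v) = cB bs v v := by
      clear hβ
      induction hw using Subgroup.closure_induction with
      | mem x hx =>
        obtain ⟨a, rfl⟩ := hx
        intro v
        rw [hs', cB_reflect _ _ _ (hrr a)]
      | one => intro v; rfl
      | mul x y _ _ hx hy => intro v; rw [LinearEquiv.mul_apply, hx, hy]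
      | inv x _ hx =>
        intro v
        rw [← hx (x⁻¹ v), ← LinearEquiv.mul_apply, mul_inv_cancel]; rfl
    rw [hinv, hrr]
  have hcoord : ∀ β ∈ Φ, bs.repr β none = (coeff β 0 : ℚ) / 2 ∧
      ∀ i, bs.repr β (some i) = (coeff β 0 : ℚ) / 2 * r0 i +
        ((∑ b : Fin 7, coeff β b.succ * Rz b i : ℤ) : ℚ) := by
    intro β hβ
    apply repr_zero
    conv_lhs => rw [hcoeff β hβ]
    rw [Fin.sum_univ_succ, h0]
    simp only [hS, ← Int.cast_smul_eq_zsmul ℚ, Finset.smul_sum, smul_smul, smul_add, add_smul,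
      Int.cast_sum, Int.cast_mul, Finset.sum_smul, Finset.sum_add_distrib]
    rw [Finset.sum_comm]
    rw [add_assoc]
    congr 1
    · congr 1; ring
    · congr 1
      refine Finset.sum_congr rfl fun i _ => ?_
      congr 1; ring
  let ht : V →ₗ[ℚ] ℚ := cBl bs ρ
  have htr : ∀ a, ht (sroot a) = 1 := by
    intro a
    have hsy : ∀ u v, cB bs u v = cB bs v u := by
      intro u v; simp [cB, mul_comm]
    simp only [ht]
    rw [cBl_apply, hsy, ← hcp, hρ, map_sum]
    simp [hω]
  have hht : ∀ β ∈ Φ, ht β = ((∑ b, coeff β b : ℤ) : ℚ) := by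
    intro β hβ
    conv_lhs => rw [hcoeff β hβ]
    simp [map_sum, htr]
  have hposht : ∀ β ∈ Φpos, 0 ≤ ht β := by
    intro β hβ
    rw [hht β (hpossub hβ)]
    exact_mod_cast Finset.sum_nonneg fun b _ => hnonneg β hβ b
  have hpos_of : ∀ β ∈ Φ, 0 < ht β → β ∈ Φpos := by
    intro β hβ h
    rcases hsign β hβ with h' | h'
    · exact h'
    · have := hposht _ h'
      rw [map_neg] at this
      linarith
  have htcoord : ∀ v, ht v = 23 * bs.repr v none +
      ∑ i : Fin 7, ((6 - (i : ℕ) : ℕ) : ℚ) * bs.repr v (some i) := by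
    intro v
    simp only [ht]
    rw [cBl_apply, cB_eq _ _ _ _ _ hρ']
  -- W1 preserves Φ
  have hWΦ : ∀ w ∈ W1, ∀ β ∈ Φ, w β ∈ Φ := by
    intro w hw
    obtain ⟨σ, η, hη, rfl⟩ := hWout w hw
    clear hη
    rw [hW1] at hw
    revert hw
    generalize sp bs σ η = w
    intro hw
    induction hw using Subgroup.closure_induction with
    | mem x hx => obtain ⟨a, _, rfl⟩ := hx; exact hsΦ a
    | one => intro β hβ; exact hβ
    | mul x y _ _ hx hy => intro β hβ; exact hx _ (hy _ hβ)
    | inv x _ hx =>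
      intro β hβ
      have hsurj := Finset.surj_on_of_inj_on_of_card_le (s := Φ) (t := Φ)
        (fun a _ => x a) (fun a ha => hx a ha) (fun a b _ _ h => x.injective h) le_rfl β hβ
      obtain ⟨a, ha, e⟩ := hsurj
      have : x⁻¹ β = a := by
        rw [e, ← LinearEquiv.mul_apply, inv_mul_cancel]; rfl
      rw [this]; exact ha
  -- roots of level 0
  have hsr6 : sroot 6 = bs (some 0) - bs (some 1) := by
    have := hS 5; simp [Fin.sum_univ_succ, Rz] at this; simpa [sub_eq_add_neg] using this
  have hΦ0 : ∀ i j : Fin 7, i ≠ j → ∀ ε : ℤˣ, bs (some i) + ((ε : ℤ) : ℚ) • bs (some j) ∈ Φ := by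
    intro i j hij ε
    obtain ⟨σ, hσ0, hσ1⟩ : ∃ σ : Equiv.Perm (Fin 7), σ 0 = i ∧ σ 1 = j := by
      have key : ∀ i j : Fin 7, i ≠ j →
          (Equiv.swap (Equiv.swap 0 i 1) j * Equiv.swap 0 i) 0 = i ∧
          (Equiv.swap (Equiv.swap 0 i 1) j * Equiv.swap 0 i) 1 = j := by decide
      exact ⟨_, key i j hij⟩
    have hm := hWΦ _ (hWin σ (Pi.mulSingle 1 (-ε) * Pi.mulSingle 6 (-ε)) (by
      revert ε; decide)) _ (hpossub (hsimple 6))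
    rw [hsr6, map_sub, sp_some, sp_some, hσ0, hσ1] at hm
    simpa [sub_eq_add_neg] using hm
  have hP0 : ∀ v, v ∈ Φpos.filter (fun α => coeff α 0 = 0) ↔
      ∃ (i j : Fin 7) (ε : ℤˣ), i < j ∧ v = bs (some i) + ((ε : ℤ) : ℚ) • bs (some j) := by
    intro v
    rw [Finset.mem_filter]
    constructor
    · rintro ⟨hv, hc⟩
      obtain ⟨c1, c2⟩ := hcoord v (hpossub hv)
      have hqv := hq v (hpossub hv)
      rw [hc] at c1 c2
      simp only [Int.cast_zero, zero_div, zero_mul, zero_add] at c1 c2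
      set m : Fin 7 → ℤ := fun i => ∑ b : Fin 7, coeff v b.succ * Rz b i with hm
      have c2' : ∀ i, bs.repr v (some i) = m i := c2
      have hsum : ∑ i, m i ^ 2 = 2 := by
        have : ((∑ i, m i ^ 2 : ℤ) : ℚ) = 2 := by
          rw [← hqv, cB]
          simp [c1, c2', sq]
        exact_mod_cast this
      obtain ⟨i, j, hij, ε, ε', e1, e2, e3⟩ := sq_sum_two m hsum
      have hv' : v = ((ε : ℤ) : ℚ) • bs (some i) + ((ε' : ℤ) : ℚ) • bs (some j) := by
        apply bs.ext_elem
        rintro (_ | k)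
        · simp [c1]
        · rw [c2']
          by_cases hi : k = i
          · subst hi
            simp [e1, Finsupp.single_apply, hij.ne']
          · by_cases hj : k = j
            · subst hj
              simp [e2, Finsupp.single_apply, hij.ne]
            · simp [e3 k hi hj, Finsupp.single_apply, Ne.symm hi, Ne.symm hj]
      refine ⟨i, j, ε', hij, ?_⟩
      rcases Int.units_eq_one_or ε with h | h
      · rw [hv', h]; simp
      · exfalso
        have := hposht v hv
        rw [htcoord] at this
        rw [hv', h] at this
        simp [Finsupp.single_apply, mul_add, Finset.sum_add_distrib] at this
        have hle : (j : ℕ) ≤ 6 := by omega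
        have hle' : (i : ℕ) ≤ 6 := by omega
        have hlt : ((i : ℕ) : ℚ) < ((j : ℕ) : ℚ) := by exact_mod_cast hij
        have hjq : ((j : ℕ) : ℚ) ≤ 6 := by exact_mod_cast hle
        rw [Nat.cast_sub hle, Nat.cast_sub hle'] at this
        push_cast at this
        rcases Int.units_eq_one_or ε' with h' | h' <;> rw [h'] at this <;> simp at this <;> linarith
    · rintro ⟨i, j, ε, hij, rfl⟩
      have hmem := hΦ0 i j hij.ne ε
      refine ⟨hpos_of _ hmem ?_, ?_⟩
      · rw [htcoord]
        simp [Finsupp.single_apply, mul_add, Finset.sum_add_distrib]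
        have hle : (j : ℕ) ≤ 6 := by omega
        have hle' : (i : ℕ) ≤ 6 := by omega
        have hlt : ((i : ℕ) : ℚ) < ((j : ℕ) : ℚ) := by exact_mod_cast hij
        have hjq : ((j : ℕ) : ℚ) ≤ 6 := by exact_mod_cast hle
        rw [Nat.cast_sub hle, Nat.cast_sub hle']
        push_cast
        rcases Int.units_eq_one_or ε with h' | h' <;> rw [h'] <;>
          simp only [Units.val_one, Units.val_neg, Int.cast_one, Int.cast_neg] <;> linarith
      · have := (hcoord _ hmem).1
        simp at this
        have h4 : (coeff (bs (some i) + ((ε : ℤ) : ℚ) • bs (some j)) 0 : ℚ) = 0 := by linarith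
        exact_mod_cast h4
  -- roots of level 2
  have hΦ2' : bs none - bs (some 0) ∈ Φ := by
    have hm := hWΦ _ (hWin 1 (fun i => if i = 0 then 1 else -1) (by decide)) _ (hpossub (hsimple 0))
    have hm2 := hsΦ 0 _ hm
    rw [hs'] at hm2
    have e : sp bs 1 (fun i => if i = 0 then 1 else -1) (sroot 0) =
        (1 / 2 : ℚ) • bs none + ∑ i, (((![-1, 1, 1, 1, 1, 1, -1] : Fin 7 → ℚ) i) / 2) • bs (some i) := by
      rw [h0, map_add, map_smul, sp_none, map_sum]
      congr 1
      refine Finset.sum_congr rfl fun i _ => ?_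
      rw [map_smul, sp_some]
      fin_cases i <;> simp [r0] <;> module
    have e2 : cB bs (sroot 0) (sp bs 1 (fun i => if i = 0 then 1 else -1) (sroot 0)) = -1 := by
      obtain ⟨r1, r2⟩ := repr_zero bs _ _ _ e
      rw [cB_eq _ _ _ _ _ h0]
      simp only [r1, r2]
      simp [Fin.sum_univ_succ, r0]; norm_num
    rw [e2, e] at hm2
    convert hm2 using 1
    rw [h0]
    simp [Fin.sum_univ_succ, r0]
    module
  have hΦ2 : ∀ (i : Fin 7) (ε : ℤˣ), bs none + ((ε : ℤ) : ℚ) • bs (some i) ∈ Φ := by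
    intro i ε
    have hm := hWΦ _ (hWin (Equiv.swap 0 i) (Pi.mulSingle 0 (-ε) * Pi.mulSingle 6 (-ε)) (by
      revert ε; decide)) _ hΦ2'
    rw [map_sub, sp_none, sp_some] at hm
    simpa [sub_eq_add_neg] using hm
  have hP2 : ∀ v, v ∈ Φpos.filter (fun α => coeff α 0 = 2) ↔
      ∃ (i : Fin 7) (ε : ℤˣ), v = bs none + ((ε : ℤ) : ℚ) • bs (some i) := by
    intro v
    rw [Finset.mem_filter]
    constructor
    · rintro ⟨hv, hc⟩
      obtain ⟨c1, c2⟩ := hcoord v (hpossub hv)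
      have hqv := hq v (hpossub hv)
      rw [hc] at c1 c2
      set m : Fin 7 → ℤ := fun i => r0 i + ∑ b : Fin 7, coeff v b.succ * Rz b i with hm
      have c1' : bs.repr v none = 1 := by rw [c1]; norm_num
      have c2' : ∀ i, bs.repr v (some i) = m i := by
        intro i
        rw [c2, hm]
        push_cast
        norm_num
      have hsum : ∑ i, m i ^ 2 = 1 := by
        have : ((∑ i, m i ^ 2 : ℤ) : ℚ) = 1 := by
          have h3 : (1 : ℚ) = 2 - 1 := by norm_num
          rw [h3, ← hqv, cB]
          simp [c1', c2', sq]
        exact_mod_cast this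
      obtain ⟨i, _, ε, e1, e3⟩ := sq_sum_one _ m hsum
      refine ⟨i, ε, ?_⟩
      apply bs.ext_elem
      rintro (_ | k)
      · simp [c1']
      · rw [c2']
        by_cases hi : k = i
        · subst hi
          simp [e1]
        · simp [e3 k (Finset.mem_univ _) hi, Finsupp.single_apply, Ne.symm hi]
    · rintro ⟨i, ε, rfl⟩
      have hmem := hΦ2 i ε
      refine ⟨hpos_of _ hmem ?_, ?_⟩
      · rw [htcoord]
        simp [Finsupp.single_apply]
        have hle' : (i : ℕ) ≤ 6 := by omega
        have hlt : (0 : ℚ) ≤ ((i : ℕ) : ℚ) := by positivity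
        have hjq : ((i : ℕ) : ℚ) ≤ 6 := by exact_mod_cast hle'
        rw [Nat.cast_sub hle']
        push_cast
        rcases Int.units_eq_one_or ε with h' | h' <;> rw [h'] <;> simp <;> linarith
      · have := (hcoord _ hmem).1
        simp at this
        have h4 : (coeff (bs none + ((ε : ℤ) : ℚ) • bs (some i)) 0 : ℚ) = 2 := by linarith
        exact_mod_cast h4
  -- assembling
  have hsumW : ∑ w ∈ hfin.toFinset, sgn w • expK (w ρ) / (1 - expK (-(w (ω 0 - ω 6)))) =
      ∑ p ∈ evenP,
      (Equiv.Perm.sign p.1 : ℤ) • expK (sp bs p.1 p.2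
          ((23 : ℚ) • bs none + ∑ i : Fin 7, ((6 - (i : ℕ) : ℕ) : ℚ) • bs (some i))) /
        (1 - expK (-(sp bs p.1 p.2 (bs none - bs (some 0))))) := by
    have hd : ω 0 - ω 6 = bs none - bs (some 0) := by
      rw [hω0, hω6]; module
    refine sum_evenP _ (sp bs) ?_ ?_ (fun σ η σ' η' h => sp_inj bs _ _ _ _ h) _ _ ?_
    · intro σ η hη
      rw [Set.Finite.mem_toFinset]
      exact hWin σ η hη
    · intro w hw
      rw [Set.Finite.mem_toFinset] at hw
      exact hWout w hw
    · intro p hp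
      rw [sgn_sp bs p.1 p.2 hp, hd, hρ']
  rw [hsumW, prod_level2 bs _ hP2]
  apply mul_left_cancel₀ (two_ne_zero_K (V := V))
  rw [← mul_assoc, sum_sp_det, mul_assoc]
  have hx : ∀ (j : Fin 7) (ε : ℤˣ), -bs none + ((ε : ℤ) : ℚ) • bs (some j) ≠ 0 := by
    intro j ε h
    have := congrArg (fun v => bs.repr v none) h
    simp at this
  rw [det_M (fun j => expK (bs (some j))) (fun j => expK_ne_zero _) (expK (-bs none))]
  · rw [← prod_level0 bs _ hP0, hω0, hρ', expK_add, expK_sum]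
    simp only [expK_nsmul]
    have : expK (-((2 : ℚ) • bs none)) = expK (-bs none) ^ 2 := by
      rw [← expK_nsmul]; congr 1; push_cast; module
    rw [this]
    ring
  · intro j
    rw [← expK_add]
    apply one_sub_expK_ne_zero
    simpa using hx j 1
  · intro j
    rw [← expK_neg, ← expK_add]
    apply one_sub_expK_ne_zero
    simpa using hx j (-1)
end
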